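/- arXiv:1404.3296 — 4 statements merged into one kernel-verified Lean document; each statement's English description precedes it below -/
import Mathlib

section
/- For every positive integer N, the singular series G(N) = Σ_{q=1}^{∞} μ(q)·C_q(−N)/φ(q)³ has the Euler product G(N) = ∏_{p | N} (1 − 1/(p−1)²) · ∏_{p ∤ N} (1 + 1/(p−1)³), the products being taken over all primes p. -/
open Finset Real
open scoped BigOperators Classical

/-- `e(x) = exp(2πix)`. -/
noncomputable def e (x : ℝ) : ℂ := Complex.exp (2 * Real.pi * Complex.I * x)

/-- The Ramanujan sum `C_q(m) = Σ_{a=1,(a,q)=1}^{q} e(ma/q)`. -/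
noncomputable def ramanujanC (q : ℕ) (m : ℤ) : ℂ :=
  ∑ a ∈ (Finset.Icc 1 q).filter (fun a => Nat.gcd a q = 1), e ((m : ℝ) * a / q)

/-- The Ramanujan sum is the `m`-th power sum of the primitive `q`-th roots of unity. -/
theorem ramanujanC_eq_sum_primitiveRoots {q : ℕ} (hq : 0 < q) (m : ℤ) :
    ramanujanC q m = ∑ ζ ∈ primitiveRoots q ℂ, ζ ^ m := by
  have hζ := Complex.isPrimitiveRoot_exp q hq.ne'
  refine Finset.sum_bij (fun a _ => Complex.exp (2 * Real.pi * Complex.I / q) ^ a) ?_ ?_ ?_ ?_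
  · intro a ha
    rw [Finset.mem_filter] at ha
    exact (mem_primitiveRoots hq).2 (hζ.pow_of_coprime a ha.2)
  · intro a ha b hb hab
    simp only [Finset.mem_filter, Finset.mem_Icc] at ha hb
    obtain rfl | hq1 := (Nat.succ_le_of_lt hq).eq_or_lt
    · omega
    · have ne {c : ℕ} (h : (1 ≤ c ∧ c ≤ q) ∧ c.gcd q = 1) : c < q := by
        refine lt_of_le_of_ne h.1.2 ?_
        rintro rfl
        simp at h
        omega
      exact hζ.pow_inj (ne ha) (ne hb) hab
  · intro ζ hmem
    have : NeZero q := ⟨hq.ne'⟩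
    obtain ⟨i, hi, hcop, rfl⟩ := hζ.isPrimitiveRoot_iff.1 ((mem_primitiveRoots hq).1 hmem)
    obtain rfl | hi0 := i.eq_zero_or_pos
    · have h1 : q = 1 := by simpa using hcop
      subst h1
      exact ⟨1, by simp, by simp⟩
    · exact ⟨i, by simp [hi.le, Nat.succ_le_of_lt hi0, hcop.gcd_eq_one], rfl⟩
  · intro a _
    rw [e, ← Complex.exp_nat_mul, ← Complex.exp_int_mul]
    congr 1
    push_cast
    ring

theorem norm_ramanujanC_le_totient (q : ℕ) (m : ℤ) : ‖ramanujanC q m‖ ≤ Nat.totient q := by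
  obtain rfl | hq := q.eq_zero_or_pos
  · simp [ramanujanC]
  rw [ramanujanC_eq_sum_primitiveRoots hq, ← Complex.card_primitiveRoots, ← nsmul_one]
  refine (norm_sum_le _ _).trans (Finset.sum_le_card_nsmul _ _ _ fun ζ hζ => ?_)
  rw [norm_zpow, ((mem_primitiveRoots hq).1 hζ).norm'_eq_one hq.ne', one_zpow]

theorem sum_divisors_ramanujanC {q : ℕ} (hq : 0 < q) (m : ℤ) :
    ∑ d ∈ q.divisors, ramanujanC d m = if (q : ℤ) ∣ m then (q : ℂ) else 0 := by
  have hζ := Complex.isPrimitiveRoot_exp q hq.ne'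
  set ζ := Complex.exp (2 * Real.pi * Complex.I / q)
  have : NeZero q := ⟨hq.ne'⟩
  have hroots : ∑ d ∈ q.divisors, ramanujanC d m =
      ∑ η ∈ Polynomial.nthRootsFinset q (1 : ℂ), η ^ m := by
    rw [IsPrimitiveRoot.nthRoots_one_eq_biUnion_primitiveRoots, Finset.sum_biUnion]
    · exact Finset.sum_congr rfl fun d hd =>
        ramanujanC_eq_sum_primitiveRoots (Nat.pos_of_mem_divisors hd) m
    · exact fun a _ b _ hab => IsPrimitiveRoot.disjoint hab
  have hgeom : ∑ η ∈ Polynomial.nthRootsFinset q (1 : ℂ), η ^ m =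
      ∑ i ∈ Finset.range q, (ζ ^ m) ^ i := by
    symm
    refine Finset.sum_bij (fun i _ => ζ ^ i) ?_ ?_ ?_ ?_
    · intro i _
      rw [Polynomial.mem_nthRootsFinset hq, ← pow_mul, mul_comm, pow_mul, hζ.pow_eq_one, one_pow]
    · intro i hi j hj
      exact fun h => hζ.pow_inj (Finset.mem_range.1 hi) (Finset.mem_range.1 hj) h
    · intro η hη
      obtain ⟨i, hi, rfl⟩ := hζ.eq_pow_of_pow_eq_one ((Polynomial.mem_nthRootsFinset hq _).1 hη)
      exact ⟨i, Finset.mem_range.2 hi, rfl⟩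
    · intro i _
      rw [← zpow_natCast, ← zpow_natCast, ← zpow_mul, ← zpow_mul, mul_comm]
  rw [hroots, hgeom]
  split_ifs with h
  · simp [(hζ.zpow_eq_one_iff_dvd m).2 h]
  · have hne : ζ ^ m ≠ 1 := fun h' => h ((hζ.zpow_eq_one_iff_dvd m).1 h')
    rw [geom_sum_eq hne, ← zpow_natCast, ← zpow_mul, mul_comm, zpow_mul, zpow_natCast,
      hζ.pow_eq_one, one_zpow, sub_self, zero_div]

/-- The arithmetic function `q ↦ q` on divisors `q` of `m`, and `0` elsewhere. -/
noncomputable def divisorIndicator (m : ℤ) : ArithmeticFunction ℂ where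
  toFun q := if (q : ℤ) ∣ m then (q : ℂ) else 0
  map_zero' := by simp

theorem isMultiplicative_divisorIndicator (m : ℤ) : (divisorIndicator m).IsMultiplicative := by
  refine ⟨by simp [divisorIndicator], fun {a b} hab => ?_⟩
  have hdvd : ((a * b : ℕ) : ℤ) ∣ m ↔ (a : ℤ) ∣ m ∧ (b : ℤ) ∣ m := by
    push_cast
    exact ⟨fun h => ⟨(dvd_mul_right _ _).trans h, (dvd_mul_left _ _).trans h⟩,
      fun h => (Nat.isCoprime_iff_coprime.2 hab).mul_dvd h.1 h.2⟩
  simp only [divisorIndicator, ArithmeticFunction.coe_mk, hdvd]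
  split_ifs <;> simp_all

/-- The Ramanujan sum as an arithmetic function of its modulus. -/
noncomputable def ramanujanArith (m : ℤ) : ArithmeticFunction ℂ where
  toFun q := ramanujanC q m
  map_zero' := by simp [ramanujanC]

theorem isMultiplicative_ramanujanArith (m : ℤ) : (ramanujanArith m).IsMultiplicative := by
  have h : ramanujanArith m = (ArithmeticFunction.moebius : ArithmeticFunction ℂ) *
      divisorIndicator m := by
    ext q
    obtain rfl | hq := q.eq_zero_or_pos
    · simp
    rw [ArithmeticFunction.mul_apply]
    exact (ArithmeticFunction.sum_eq_iff_sum_mul_moebius_eq.1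
      (fun n hn => sum_divisors_ramanujanC hn m) q hq).symm
  rw [h]
  exact ArithmeticFunction.isMultiplicative_moebius.intCast.mul
    (isMultiplicative_divisorIndicator m)

theorem ramanujanC_prime {p : ℕ} (hp : p.Prime) (m : ℤ) :
    ramanujanC p m = (if (p : ℤ) ∣ m then (p : ℂ) else 0) - 1 := by
  have h := sum_divisors_ramanujanC hp.pos m
  have h1 := sum_divisors_ramanujanC one_pos m
  rw [hp.sum_divisors] at h
  simp only [Nat.divisors_one, Finset.sum_singleton, Nat.cast_one, one_dvd, if_true] at h1
  rw [← h, h1]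
  ring

/-- The summand of the singular series. -/
noncomputable def singularTerm (m : ℤ) : ArithmeticFunction ℂ where
  toFun q := (ArithmeticFunction.moebius q : ℂ) * ramanujanC q m / (Nat.totient q : ℂ) ^ 3
  map_zero' := by simp

theorem isMultiplicative_singularTerm (m : ℤ) : (singularTerm m).IsMultiplicative := by
  have hC := isMultiplicative_ramanujanArith m
  refine ⟨?_, fun {a b} hab => ?_⟩
  · have := hC.1
    simp only [ramanujanArith, ArithmeticFunction.coe_mk] at this
    simp [singularTerm, this]
  · have := hC.2 hab
    simp only [ramanujanArith, ArithmeticFunction.coe_mk] at this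
    simp only [singularTerm, ArithmeticFunction.coe_mk, this,
      ArithmeticFunction.isMultiplicative_moebius.2 hab, Nat.totient_mul hab]
    push_cast
    ring

theorem singularTerm_prime_pow {p : ℕ} (hp : p.Prime) (m : ℤ) {k : ℕ} (hk : 2 ≤ k) :
    singularTerm m (p ^ k) = 0 := by
  have : k ≠ 1 := by omega
  simp [singularTerm, ArithmeticFunction.moebius_apply_prime_pow hp (by omega : k ≠ 0), this]

theorem singularTerm_prime {p : ℕ} (hp : p.Prime) (m : ℤ) :
    singularTerm m p =
      if (p : ℤ) ∣ m then -(1 / ((p : ℂ) - 1) ^ 2) else 1 / ((p : ℂ) - 1) ^ 3 := by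
  have hp1 : (p : ℂ) - 1 ≠ 0 := sub_ne_zero.2 (by exact_mod_cast hp.one_lt.ne')
  simp only [singularTerm, ArithmeticFunction.coe_mk, ramanujanC_prime hp,
    ArithmeticFunction.moebius_apply_prime hp, Nat.totient_prime hp,
    Nat.cast_sub hp.one_lt.le]
  split_ifs
  · push_cast
    field_simp
  · simp

theorem summable_norm_singularTerm_primes (m : ℤ) :
    Summable fun p : Nat.Primes => ‖singularTerm m p‖ := by
  have hs : Summable fun n : ℕ => 4 * (1 / (n : ℝ) ^ 2) :=
    (Real.summable_one_div_nat_pow.2 one_lt_two).mul_left 4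
  refine Summable.of_nonneg_of_le (fun _ => norm_nonneg _) (fun p => ?_)
    (hs.comp_injective Nat.Primes.coe_nat_injective)
  change ‖singularTerm m p‖ ≤ 4 * (1 / ((p : ℕ) : ℝ) ^ 2)
  have hp := p.2
  have hp2 : (2 : ℝ) ≤ (p : ℕ) := by exact_mod_cast hp.two_le
  have hC := norm_ramanujanC_le_totient p m
  rw [Nat.totient_prime hp, Nat.cast_sub hp.one_lt.le, Nat.cast_one] at hC
  have hφ : ‖((Nat.totient p : ℕ) : ℂ)‖ = (p : ℕ) - (1 : ℝ) := by
    rw [Complex.norm_natCast, Nat.totient_prime hp, Nat.cast_sub hp.one_lt.le, Nat.cast_one]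
  simp only [singularTerm, ArithmeticFunction.coe_mk,
    ArithmeticFunction.moebius_apply_prime hp, norm_div, norm_mul, norm_pow, hφ]
  have h1 : (0 : ℝ) < (p : ℕ) - 1 := by linarith
  rw [mul_one_div, div_le_div_iff₀ (by positivity) (by positivity)]
  simp only [Int.cast_neg, Int.cast_one, norm_neg, norm_one, one_mul]
  calc ‖ramanujanC p m‖ * ((p : ℕ) : ℝ) ^ 2
      ≤ (((p : ℕ) : ℝ) - 1) * (2 * (((p : ℕ) : ℝ) - 1)) ^ 2 := by gcongr; linarith
    _ = 4 * (((p : ℕ) : ℝ) - 1) ^ 3 := by ring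

/-- If `f` vanishes at the prime powers `p ^ k` with `2 ≤ k`, only two terms of its
local factor at `p` survive. -/
theorem hasSum_prime_pow {R : Type*} [NormedRing R] {f : ℕ → R} (h1 : f 1 = 1) {p : ℕ}
    (hf : ∀ k, 2 ≤ k → f (p ^ k) = 0) : HasSum (fun k => f (p ^ k)) (1 + f p) := by
  have h : HasSum (fun k => f (p ^ k)) _ :=
    hasSum_sum_of_ne_finset_zero (f := fun k => f (p ^ k)) (s := Finset.range 2)
    (fun k hk => hf k (not_lt.1 fun h => hk (Finset.mem_range.2 h)))
  simpa [Finset.sum_range_succ, h1] using h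

/-- The primes in a finite set of natural numbers. -/
def Finset.toPrimes (s : Finset ℕ) : Finset Nat.Primes := s.subtype Nat.Prime

theorem Finset.mem_toPrimes {s : Finset ℕ} {p : Nat.Primes} : p ∈ s.toPrimes ↔ (p : ℕ) ∈ s :=
  Finset.mem_subtype

/-- A product over a finite set of primes, indexed by the type of primes. -/
@[to_additive]
theorem prod_eq_prod_subtype_prime {M : Type*} [CommMonoid M] {s : Finset ℕ}
    (hs : ∀ p ∈ s, p.Prime) (g : ℕ → M) :
    ∏ p ∈ s, g p = ∏ p ∈ s.toPrimes, g p := by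
  have h := Finset.prod_subtype_eq_prod_filter (s := s) (p := Nat.Prime) g
  rw [Finset.filter_true_of_mem hs] at h
  exact h.symm

/-- A multiplicative function supported on squarefree numbers is absolutely summable as soon as
it is absolutely summable over the primes. -/
theorem ArithmeticFunction.IsMultiplicative.summable_norm_of_primes {f : ArithmeticFunction ℂ}
    (hf : f.IsMultiplicative) (hpow : ∀ p : ℕ, p.Prime → ∀ k, 2 ≤ k → f (p ^ k) = 0)
    (hsum : Summable fun p : Nat.Primes => ‖f p‖) : Summable fun n => ‖f n‖ := by
  have hone : ‖f 1‖ = 1 := by simp [hf.1]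
  have hlocal {p : ℕ} (hp : p.Prime) : HasSum (fun k => ‖f (p ^ k)‖) (1 + ‖f p‖) :=
    hasSum_prime_pow (f := fun n => ‖f n‖) hone fun k hk => by simp [hpow p hp k hk]
  refine summable_of_sum_le (c := Real.exp (∑' p : Nat.Primes, ‖f p‖))
    (fun _ => norm_nonneg _) fun u => ?_
  set M := u.sup id + 1
  obtain ⟨hs, hp⟩ := EulerProduct.summable_and_hasSum_smoothNumbers_prod_primesBelow_tsum
    (f := fun n => ‖f n‖) hone (fun {a b} hab => by simp [hf.2 hab])
    (fun {p} hp => by simpa using (hlocal hp).summable) M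
  have hu : ∑ n ∈ u, ‖f n‖ = ∑ n ∈ u.subtype (· ∈ M.smoothNumbers), ‖f n‖ := by
    rw [Finset.sum_subtype_eq_sum_filter (f := fun n => ‖f n‖)]
    symm
    refine Finset.sum_filter_of_ne fun n hn hne => ?_
    refine Nat.mem_smoothNumbers_of_lt (Nat.pos_of_ne_zero ?_)
      (Nat.lt_succ_of_le (Finset.le_sup (f := id) hn))
    rintro rfl
    simp at hne
  calc ∑ n ∈ u, ‖f n‖
      ≤ ∏ p ∈ M.primesBelow, ∑' k, ‖f (p ^ k)‖ :=
        hu.trans_le (sum_le_hasSum _ (fun _ _ => norm_nonneg _) hp)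
    _ = ∏ p ∈ M.primesBelow, (1 + ‖f p‖) :=
        Finset.prod_congr rfl fun p hp => (hlocal (Nat.prime_of_mem_primesBelow hp)).tsum_eq
    _ ≤ ∏ p ∈ M.primesBelow, Real.exp ‖f p‖ := by
        refine Finset.prod_le_prod (fun _ _ => by positivity) fun p _ => ?_
        rw [add_comm]
        exact Real.add_one_le_exp _
    _ = Real.exp (∑ p ∈ M.primesBelow, ‖f p‖) := (Real.exp_sum _ _).symm
    _ ≤ Real.exp (∑' p : Nat.Primes, ‖f p‖) := by
        refine Real.exp_le_exp.2 ?_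
        rw [sum_eq_sum_subtype_prime fun p hp => Nat.prime_of_mem_primesBelow hp]
        exact hsum.sum_le_tsum _ fun _ _ => norm_nonneg _

theorem stmt3 (N : ℕ) (hN : 0 < N) :
    (∑' q : ℕ,
        (ArithmeticFunction.moebius q : ℂ) * ramanujanC q (-(N : ℤ)) / (Nat.totient q : ℂ) ^ 3) =
      (∏ p ∈ N.primeFactors, (1 - 1 / ((p : ℂ) - 1) ^ 2)) *
        ∏' p : {p : Nat.Primes // ¬ ((p : ℕ) ∣ N)}, (1 + 1 / (((p.1 : ℕ) : ℂ) - 1) ^ 3) := by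
  set f := singularTerm (-(N : ℤ)) with hf_def
  have hf : f.IsMultiplicative := isMultiplicative_singularTerm _
  have hpow (p : ℕ) (hp : p.Prime) (k : ℕ) (hk : 2 ≤ k) : f (p ^ k) = 0 :=
    singularTerm_prime_pow hp _ hk
  have hsum := summable_norm_singularTerm_primes (-(N : ℤ))
  have heuler := hf.eulerProduct_hasProd (hf.summable_norm_of_primes hpow hsum)
  have hlocal (p : Nat.Primes) : ∑' k, f ((p : ℕ) ^ k) = 1 + f p :=
    (hasSum_prime_pow hf.1 (hpow p p.2)).tsum_eq
  simp only [hlocal] at heuler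
  let s : Set Nat.Primes := {p | (p : ℕ) ∣ N}
  have hval (p : Nat.Primes) : f p =
      if (p : ℕ) ∣ N then -(1 / (((p : ℕ) : ℂ) - 1) ^ 2) else 1 / (((p : ℕ) : ℂ) - 1) ^ 3 := by
    simp only [hf_def, singularTerm_prime p.2, dvd_neg, Int.natCast_dvd_natCast]
  have hdvd : HasProd ((fun p : Nat.Primes => 1 + f p) ∘ (↑) : s → ℂ)
      (∏ p ∈ N.primeFactors, (1 - 1 / ((p : ℂ) - 1) ^ 2)) := by
    have hprod : ∏ p ∈ N.primeFactors, (1 - 1 / ((p : ℂ) - 1) ^ 2) =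
        ∏ p ∈ N.primeFactors.toPrimes,
          s.mulIndicator (fun p => 1 + f p) p := by
      rw [prod_eq_prod_subtype_prime fun p hp => Nat.prime_of_mem_primeFactors hp]
      refine Finset.prod_congr rfl fun p hp => ?_
      have hpN : (p : ℕ) ∣ N := Nat.dvd_of_mem_primeFactors (Finset.mem_toPrimes.1 hp)
      rw [Set.mulIndicator_of_mem (show (p : Nat.Primes) ∈ s from hpN)]
      have := hval p
      rw [if_pos hpN] at this
      rw [this, sub_eq_add_neg]
    rw [hasProd_subtype_iff_mulIndicator, hprod]
    refine hasProd_prod_of_ne_finset_one fun p hp => Set.mulIndicator_of_notMem (fun h => hp ?_) _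
    exact Finset.mem_toPrimes.2 (Nat.mem_primeFactors.2 ⟨p.2, h, hN.ne'⟩)
  have hcompl : Multipliable ((fun p : Nat.Primes => 1 + f p) ∘ (↑) : ↑sᶜ → ℂ) :=
    multipliable_one_add_of_summable (hsum.comp_injective Subtype.val_injective)
  have hmul := hdvd.mul_compl hcompl.hasProd
  refine (heuler.unique hmul).trans ?_
  congr 1
  refine tprod_congr fun p => ?_
  have := hval p.1
  rw [if_neg (show ¬ ((p.1 : ℕ) ∣ N) from p.2)] at this
  simp only [Function.comp_apply, this]
end

section
/- If N is an even positive integer, then G(N) = Σ_{q=1}^{∞} μ(q)·C_q(−N)/φ(q)³ = 0, and the modified singular series D(N) = Σ_{q odd} μ(q)·C_q(−N)/φ(q)³ − Σ_{q even} μ(q)·C_q(−N)/φ(q)³ satisfies D(N) = 2·Σ_{q odd} μ(q)·C_q(−N)/φ(q)³ = 2·∏_{p | N, p odd} (1 − 1/(p−1)²) · ∏_{p ∤ N} (1 + 1/(p−1)³). -/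
open Finset Real
open scoped BigOperators Classical

/-- The general term `μ(q)·C_q(−N)/φ(q)³` of the singular series. -/
noncomputable def termD (N q : ℕ) : ℂ :=
  (ArithmeticFunction.moebius q : ℂ) * ramanujanC q (-(N : ℤ)) / (Nat.totient q : ℂ) ^ 3

theorem e_mul_div_eq (m : ℤ) (a q : ℕ) :
    e ((m : ℝ) * a / q) = (Complex.exp (2 * Real.pi * Complex.I / q) ^ a) ^ m := by
  rw [e, ← Complex.exp_nat_mul, ← Complex.exp_int_mul]
  congr 1
  push_cast
  ring

theorem IsPrimitiveRoot.mul_of_coprime {M : Type*} [CommMonoid M] {ζ ξ : M} {m n : ℕ}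
    (hζ : IsPrimitiveRoot ζ m) (hξ : IsPrimitiveRoot ξ n) (h : m.Coprime n) :
    IsPrimitiveRoot (ζ * ξ) (m * n) := by
  rw [IsPrimitiveRoot.iff_orderOf, hζ.eq_orderOf, hξ.eq_orderOf]
  rw [hζ.eq_orderOf, hξ.eq_orderOf] at h
  exact (Commute.all ζ ξ).orderOf_mul_eq_mul_orderOf_of_coprime h

theorem primitiveRoots_mul_injOn {m n : ℕ} (hm : 0 < m) (hn : 0 < n) (h : m.Coprime n) :
    Set.InjOn (fun x : ℂ × ℂ => x.1 * x.2)
      (primitiveRoots m ℂ ×ˢ primitiveRoots n ℂ : Finset (ℂ × ℂ)) := by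
  rintro ⟨a, b⟩ hab ⟨c, d⟩ hcd heq
  simp only [Finset.coe_product, Set.mem_prod, Finset.mem_coe, mem_primitiveRoots hm,
    mem_primitiveRoots hn] at hab hcd heq
  have hc0 := hcd.1.ne_zero hm.ne'
  have hb0 := hab.2.ne_zero hn.ne'
  have hdiv : a / c = d / b := by
    rw [div_eq_div_iff hc0 hb0, heq, mul_comm]
  have h1 : (a / c) ^ m = 1 := by simp [div_pow, hab.1.pow_eq_one, hcd.1.pow_eq_one]
  have h2 : (a / c) ^ n = 1 := by simp [hdiv, div_pow, hab.2.pow_eq_one, hcd.2.pow_eq_one]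
  have h3 : a / c = 1 := by
    have := (pow_gcd_eq_one (a := a / c)).2 ⟨h1, h2⟩
    rwa [h.gcd_eq_one, pow_one] at this
  have hac : a = c := (div_eq_one_iff_eq hc0).1 h3
  have hbd : d = b := (div_eq_one_iff_eq hb0).1 (hdiv ▸ h3)
  rw [hac, hbd]

theorem image_mul_primitiveRoots {m n : ℕ} (hm : 0 < m) (hn : 0 < n) (h : m.Coprime n) :
    (primitiveRoots m ℂ ×ˢ primitiveRoots n ℂ).image (fun x : ℂ × ℂ => x.1 * x.2) =
      primitiveRoots (m * n) ℂ := by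
  apply Finset.eq_of_subset_of_card_le
  · intro x hx
    simp only [Finset.mem_image, Finset.mem_product, mem_primitiveRoots hm,
      mem_primitiveRoots hn] at hx
    obtain ⟨⟨a, b⟩, ⟨ha, hb⟩, rfl⟩ := hx
    exact (mem_primitiveRoots (Nat.mul_pos hm hn)).2 (ha.mul_of_coprime hb h)
  · rw [Finset.card_image_of_injOn (primitiveRoots_mul_injOn hm hn h), Finset.card_product]
    simp only [Complex.card_primitiveRoots]
    rw [Nat.totient_mul h]

theorem ramanujanC_mul {m n : ℕ} (hm : 0 < m) (hn : 0 < n) (h : m.Coprime n) (k : ℤ) :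
    ramanujanC (m * n) k = ramanujanC m k * ramanujanC n k := by
  rw [ramanujanC_eq_sum_primitiveRoots (Nat.mul_pos hm hn), ramanujanC_eq_sum_primitiveRoots hm,
    ramanujanC_eq_sum_primitiveRoots hn, ← image_mul_primitiveRoots hm hn h,
    Finset.sum_image (primitiveRoots_mul_injOn hm hn h), Finset.sum_mul_sum, Finset.sum_product]
  simp only [mul_zpow]

theorem ramanujanC_one (k : ℤ) : ramanujanC 1 k = 1 := by
  rw [ramanujanC_eq_sum_primitiveRoots one_pos]
  simp

theorem ramanujanC_of_dvd {q : ℕ} (hq : 0 < q) {k : ℤ} (h : (q : ℤ) ∣ k) :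
    ramanujanC q k = q.totient := by
  rw [ramanujanC_eq_sum_primitiveRoots hq, Finset.sum_congr rfl
    (fun ζ hζ => ((isPrimitiveRoot_of_mem_primitiveRoots hζ).zpow_eq_one_iff_dvd k).2 h)]
  simp [Complex.card_primitiveRoots]

theorem ramanujanC_prime_of_not_dvd {p : ℕ} (hp : p.Prime) {k : ℤ} (h : ¬ (p : ℤ) ∣ k) :
    ramanujanC p k = -1 := by
  have hset : (Finset.Icc 1 p).filter (fun a => Nat.gcd a p = 1) = (Finset.range p).erase 0 := by
    ext a
    simp only [Finset.mem_filter, Finset.mem_Icc, Finset.mem_erase, Finset.mem_range]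
    constructor
    · rintro ⟨⟨h1, h2⟩, h3⟩
      refine ⟨by omega, lt_of_le_of_ne h2 ?_⟩
      rintro rfl
      rw [Nat.gcd_self] at h3
      exact hp.one_lt.ne' h3
    · rintro ⟨h1, h2⟩
      exact ⟨⟨by omega, h2.le⟩,
        (hp.coprime_iff_not_dvd.2 (Nat.not_dvd_of_pos_of_lt (by omega) h2)).symm⟩
  have hprim : IsPrimitiveRoot (Complex.exp (2 * Real.pi * Complex.I / p) ^ k) p := by
    refine (Complex.isPrimitiveRoot_exp p hp.ne_zero).zpow_of_gcd_eq_one k ?_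
    rw [← Int.isCoprime_iff_gcd_eq_one]
    exact ((Nat.prime_iff_prime_int.1 hp).coprime_iff_not_dvd.2 h).symm
  have hgeom := hprim.geom_sum_eq_zero hp.one_lt
  rw [← Finset.add_sum_erase _ _ (Finset.mem_range.2 hp.pos), pow_zero] at hgeom
  rw [ramanujanC, hset, ← eq_neg_of_add_eq_zero_right hgeom]
  refine Finset.sum_congr rfl fun a _ => ?_
  rw [e_mul_div_eq, ← zpow_natCast, ← zpow_natCast, zpow_comm]

theorem termD_one (N : ℕ) : termD N 1 = 1 := by
  simp [termD, ramanujanC_one]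

theorem termD_zero (N : ℕ) : termD N 0 = 0 := by
  simp [termD]

theorem termD_of_not_squarefree (N : ℕ) {q : ℕ} (h : ¬ Squarefree q) : termD N q = 0 := by
  simp [termD, ArithmeticFunction.moebius_eq_zero_of_not_squarefree h]

theorem termD_mul (N : ℕ) {m n : ℕ} (h : m.Coprime n) :
    termD N (m * n) = termD N m * termD N n := by
  rcases Nat.eq_zero_or_pos m with rfl | hm
  · simp [termD_zero]
  rcases Nat.eq_zero_or_pos n with rfl | hn
  · simp [termD_zero]
  rw [termD, termD, termD, ramanujanC_mul hm hn h,
    ArithmeticFunction.isMultiplicative_moebius.map_mul_of_coprime h, Nat.totient_mul h]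
  push_cast
  rw [mul_pow, div_mul_div_comm]
  ring

theorem termD_prime_of_dvd {N p : ℕ} (hp : p.Prime) (h : p ∣ N) :
    termD N p = -(1 / ((p : ℂ) - 1) ^ 2) := by
  have h0 : (p : ℂ) - 1 ≠ 0 := sub_ne_zero.2 (by exact_mod_cast hp.one_lt.ne')
  rw [termD, ramanujanC_of_dvd hp.pos ((Int.natCast_dvd_natCast.2 h).neg_right),
    ArithmeticFunction.moebius_apply_prime hp, Nat.totient_prime hp, Nat.cast_sub hp.one_le]
  push_cast
  field_simp

theorem termD_prime_of_not_dvd {N p : ℕ} (hp : p.Prime) (h : ¬ p ∣ N) :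
    termD N p = 1 / ((p : ℂ) - 1) ^ 3 := by
  rw [termD, ramanujanC_prime_of_not_dvd hp (by rwa [Int.dvd_neg, Int.natCast_dvd_natCast]),
    ArithmeticFunction.moebius_apply_prime hp, Nat.totient_prime hp, Nat.cast_sub hp.one_le]
  push_cast
  ring

theorem norm_natCast_sub_one_ge {p : ℕ} (hp : 2 ≤ p) : (p : ℝ) / 2 ≤ ‖(p : ℂ) - 1‖ := by
  have h2 : (2 : ℝ) ≤ p := by exact_mod_cast hp
  have : (p : ℂ) - 1 = ((p - 1 : ℝ) : ℂ) := by push_cast; rfl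
  rw [this, Complex.norm_real, Real.norm_eq_abs, abs_of_nonneg (by linarith)]
  linarith

theorem norm_one_div_natCast_sub_one_pow_le {p : ℕ} (hp : 2 ≤ p) (k : ℕ) :
    ‖1 / ((p : ℂ) - 1) ^ k‖ ≤ 2 ^ k * (1 / (p : ℝ) ^ k) := by
  have h0 : (0 : ℝ) < p := by exact_mod_cast (by omega : 0 < p)
  rw [norm_div, norm_one, norm_pow]
  calc 1 / ‖(p : ℂ) - 1‖ ^ k ≤ 1 / ((p : ℝ) / 2) ^ k := by
        gcongr
        exact norm_natCast_sub_one_ge hp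
    _ = 2 ^ k * (1 / (p : ℝ) ^ k) := by rw [div_pow]; field_simp

theorem norm_termD_prime_le (N : ℕ) {p : ℕ} (hp : p.Prime) :
    ‖termD N p‖ ≤ 8 * (1 / (p : ℝ) ^ 2) := by
  have h1 : (1 : ℝ) ≤ p := by exact_mod_cast hp.one_le
  by_cases h : p ∣ N
  · rw [termD_prime_of_dvd hp h, norm_neg]
    refine (norm_one_div_natCast_sub_one_pow_le hp.two_le 2).trans ?_
    gcongr
    norm_num
  · rw [termD_prime_of_not_dvd hp h]
    refine (norm_one_div_natCast_sub_one_pow_le hp.two_le 3).trans ?_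
    norm_num only
    gcongr
    norm_num

theorem termD_eq_prod_primeFactors (N : ℕ) {q : ℕ} (h : Squarefree q) :
    termD N q = ∏ p ∈ q.primeFactors, termD N p := by
  let f : ArithmeticFunction ℂ := ⟨termD N, termD_zero N⟩
  have hf : f.IsMultiplicative := ⟨termD_one N, fun hmn => termD_mul N hmn⟩
  exact (hf.prod_primeFactors h).symm

theorem summable_norm_termD (N : ℕ) : Summable fun q => ‖termD N q‖ := by
  let g : ℕ → ℝ := fun p => if p.Prime then ‖termD N p‖ else 0
  have hg0 : ∀ p, 0 ≤ g p := fun p => by dsimp only [g]; split_ifs <;> positivity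
  have hg : Summable g := by
    refine Summable.of_nonneg_of_le hg0 (fun p => ?_)
      ((Real.summable_one_div_nat_pow.2 one_lt_two).mul_left 8)
    dsimp only [g]
    split_ifs with hp
    · exact norm_termD_prime_le N hp
    · positivity
  have hinj : Function.Injective fun q : {q : ℕ // Squarefree q} => (q : ℕ).primeFactors := by
    rintro ⟨a, ha⟩ ⟨b, hb⟩ hab
    change a.primeFactors = b.primeFactors at hab
    rw [Subtype.mk.injEq, ← Nat.prod_primeFactors_of_squarefree ha, hab,
      Nat.prod_primeFactors_of_squarefree hb]
  have hsum := (summable_finsetProd_of_summable_nonneg hg0 hg).comp_injective hinj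
  refine (Subtype.val_injective (p := fun q : ℕ => Squarefree q)).summable_iff (fun q hq => ?_) |>.1
    (hsum.congr fun q => ?_)
  · rw [termD_of_not_squarefree N (by simpa using hq), norm_zero]
  · simp only [Function.comp_apply]
    rw [termD_eq_prod_primeFactors N q.2, norm_prod]
    exact Finset.prod_congr rfl fun p hp => by simp [g, Nat.prime_of_mem_primeFactors hp]

theorem hasProd_one_add_of_multiplicative {f : ℕ → ℂ} (h1 : f 1 = 1) (h0 : f 0 = 0)
    (hmul : ∀ {m n : ℕ}, m.Coprime n → f (m * n) = f m * f n)
    (hsq : ∀ q, ¬ Squarefree q → f q = 0) (hsum : Summable fun q => ‖f q‖) :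
    HasProd (fun p : Nat.Primes => 1 + f p) (∑' q, f q) := by
  convert EulerProduct.eulerProduct_hasProd h1 hmul hsum h0 using 2 with p
  rw [tsum_eq_sum (s := Finset.range 2)]
  · simp [Finset.sum_range_succ, h1]
  · intro k hk
    refine hsq _ fun hsf => ?_
    have hk2 : 2 ≤ k := not_lt.1 (Finset.mem_range.not.1 hk)
    exact p.2.prime.not_isUnit (hsf _ (by rw [← sq]; exact pow_dvd_pow _ hk2))

theorem tsum_termD_eq_zero {N : ℕ} (hN : Even N) : ∑' q, termD N q = 0 := by
  have hprod := hasProd_one_add_of_multiplicative (termD_one N) (termD_zero N) (termD_mul N)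
    (fun _ => termD_of_not_squarefree N) (summable_norm_termD N)
  refine hprod.unique (hasProd_zero_of_exists_eq_zero ⟨⟨2, Nat.prime_two⟩, ?_⟩)
  rw [termD_prime_of_dvd Nat.prime_two hN.two_dvd]
  norm_num

theorem hasProd_odd_termD (N : ℕ) :
    HasProd (fun p : Nat.Primes => 1 + if Odd (p : ℕ) then termD N p else 0)
      (∑' q : ℕ, if Odd q then termD N q else 0) := by
  refine hasProd_one_add_of_multiplicative (f := fun q => if Odd q then termD N q else 0)
    (by simp [termD_one]) (by simp) (fun {m n} h => ?_) (fun q hq => ?_) ?_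
  · simp only [Nat.odd_mul, termD_mul N h]
    by_cases hm : Odd m <;> by_cases hn : Odd n <;> simp [hm, hn]
  · simp [termD_of_not_squarefree N hq]
  · refine (summable_norm_termD N).of_nonneg_of_le (fun _ => norm_nonneg _) fun q => ?_
    split_ifs <;> simp

theorem multipliable_one_add_one_div_sub_one_cube (N : ℕ) :
    Multipliable fun p : {p : Nat.Primes // ¬ ((p : ℕ) ∣ N)} =>
      (1 + 1 / (((p.1 : ℕ) : ℂ) - 1) ^ 3) := by
  apply multipliable_one_add_of_summable
  have hsum : Summable fun p : {p : Nat.Primes // ¬ ((p : ℕ) ∣ N)} =>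
      (2 : ℝ) ^ 3 * (1 / ((p.1 : ℕ) : ℝ) ^ 3) :=
    ((Real.summable_one_div_nat_pow.2 (by norm_num : 1 < 3)).mul_left (2 ^ 3)).comp_injective
      (Nat.Primes.coe_nat_injective.comp Subtype.val_injective)
  exact hsum.of_nonneg_of_le (fun _ => norm_nonneg _)
    fun p => norm_one_div_natCast_sub_one_pow_le p.1.2.two_le 3

theorem tsum_odd_termD_eq {N : ℕ} (hN : 0 < N) (hEven : Even N) :
    (∑' q : ℕ, if Odd q then termD N q else 0) =
      (∏ p ∈ N.primeFactors.filter (fun p => Odd p), (1 - 1 / ((p : ℂ) - 1) ^ 2)) *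
        ∏' p : {p : Nat.Primes // ¬ ((p : ℕ) ∣ N)}, (1 + 1 / (((p.1 : ℕ) : ℂ) - 1) ^ 3) := by
  have hodd : ∀ p : Nat.Primes, ¬ (p : ℕ) ∣ N → Odd (p : ℕ) := fun p hp =>
    p.2.odd_of_ne_two fun h2 => hp (h2 ▸ hEven.two_dvd)
  let T : Finset Nat.Primes := (N.primeFactors.filter (fun p => Odd p)).subtype Nat.Prime
  let F : Nat.Primes → ℂ := fun p =>
    if (p : ℕ) ∣ N ∧ Odd (p : ℕ) then 1 - 1 / (((p : ℕ) : ℂ) - 1) ^ 2 else 1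
  have hF : HasProd F (∏ p ∈ N.primeFactors.filter (fun p => Odd p),
      (1 - 1 / ((p : ℂ) - 1) ^ 2)) := by
    have hT : ∏ p ∈ T, F p = ∏ p ∈ N.primeFactors.filter (fun p => Odd p),
        (1 - 1 / ((p : ℂ) - 1) ^ 2) := by
      rw [← Finset.prod_subtype_of_mem (p := Nat.Prime) _
        (fun p hp => Nat.prime_of_mem_primeFactors (Finset.mem_filter.1 hp).1)]
      refine Finset.prod_congr rfl fun p hp => if_pos ?_
      obtain ⟨hpN, hp_odd⟩ := Finset.mem_filter.1 (Finset.mem_subtype.1 hp)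
      exact ⟨Nat.dvd_of_mem_primeFactors hpN, hp_odd⟩
    rw [← hT]
    refine hasProd_prod_of_ne_finset_one fun p hp => if_neg fun h => hp ?_
    exact Finset.mem_subtype.2
      (Finset.mem_filter.2 ⟨Nat.mem_primeFactors.2 ⟨p.2, h.1, hN.ne'⟩, h.2⟩)
  have hG := (hasProd_subtype_iff_mulIndicator (s := {p : Nat.Primes | ¬ (p : ℕ) ∣ N})
    (f := fun p : Nat.Primes => 1 + 1 / (((p : ℕ) : ℂ) - 1) ^ 3)).1
    (multipliable_one_add_one_div_sub_one_cube N).hasProd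
  refine (hasProd_odd_termD N).unique ((hF.mul hG).congr_fun fun p => ?_)
  by_cases hp : (p : ℕ) ∣ N
  · by_cases ho : Odd (p : ℕ)
    · simp [F, hp, ho, termD_prime_of_dvd p.2 hp, sub_eq_add_neg]
    · simp [F, hp, ho]
  · simp [F, hp, hodd p hp, termD_prime_of_not_dvd p.2 hp]

theorem tsum_odd_add_tsum_even_termD (N : ℕ) :
    (∑' q : ℕ, if Odd q then termD N q else 0) + (∑' q : ℕ, if Even q then termD N q else 0) =
      ∑' q, termD N q := by
  have hs (P : ℕ → Prop) [DecidablePred P] : Summable fun q => if P q then termD N q else 0 :=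
    Summable.of_norm <| (summable_norm_termD N).of_nonneg_of_le (fun _ => norm_nonneg _)
      fun q => by split_ifs <;> simp
  rw [← (hs _).tsum_add (hs _)]
  refine tsum_congr fun q => ?_
  rcases Nat.even_or_odd q with h | h
  · simp [h, Nat.not_odd_iff_even.2 h]
  · simp [h, Nat.not_even_iff_odd.2 h]

theorem stmt4 (N : ℕ) (hN : 0 < N) (hEven : Even N) :
    (∑' q : ℕ, termD N q) = 0 ∧
    ((∑' q : ℕ, if Odd q then termD N q else 0) -
        (∑' q : ℕ, if Even q then termD N q else 0)) =
      2 * ∑' q : ℕ, (if Odd q then termD N q else 0) ∧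
    (2 * ∑' q : ℕ, (if Odd q then termD N q else 0)) =
      2 * (∏ p ∈ N.primeFactors.filter (fun p => Odd p), (1 - 1 / ((p : ℂ) - 1) ^ 2)) *
        ∏' p : {p : Nat.Primes // ¬ ((p : ℕ) ∣ N)}, (1 + 1 / (((p.1 : ℕ) : ℂ) - 1) ^ 3) := by
  have hzero := tsum_termD_eq_zero hEven
  refine ⟨hzero, ?_, ?_⟩
  · rw [← tsum_odd_add_tsum_even_termD] at hzero
    rw [eq_neg_of_add_eq_zero_right hzero]
    ring
  · rw [tsum_odd_termD_eq hN hEven, mul_assoc]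
end

section
/- There exist absolute positive constants c₁ and c₂ such that for every even positive integer N, the singular series D(N) = 2·∏_{p | N, p odd} (1 − 1/(p−1)²) · ∏_{p ∤ N} (1 + 1/(p−1)³) satisfies c₁ < D(N) < c₂. -/
open Finset Real
open scoped BigOperators Classical

/-- The singular series `D(N) = 2 ∏_{p∣N, p odd} (1 - 1/(p-1)²) ∏_{p∤N} (1 + 1/(p-1)³)`. -/
noncomputable def singularD (N : ℕ) : ℝ :=
  2 * (∏ p ∈ N.primeFactors.filter (fun p => Odd p), (1 - 1 / ((p : ℝ) - 1) ^ 2)) *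
    ∏' p : {p : Nat.Primes // ¬ ((p : ℕ) ∣ N)}, (1 + 1 / (((p.1 : ℕ) : ℝ) - 1) ^ 3)

theorem half_le_prod_Ico_one_sub_inv_sq (n : ℕ) :
    (1 / 2 : ℝ) ≤ ∏ k ∈ Ico 3 (n + 3), (1 - 1 / ((k : ℝ) - 1) ^ 2) := by
  have telescope : ∏ k ∈ Ico 3 (n + 3), (1 - 1 / ((k : ℝ) - 1) ^ 2) =
      ((n : ℝ) + 2) / (2 * ((n : ℝ) + 1)) := by
    induction n with
    | zero => norm_num
    | succ n ih =>
      rw [show n + 1 + 3 = (n + 3) + 1 by ring, prod_Ico_succ_top (by omega), ih]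
      have h : (n : ℝ) + 3 - 1 = n + 2 := by ring
      push_cast
      rw [h]
      field_simp
      ring
  rw [telescope, div_le_div_iff₀ (by norm_num) (by positivity)]
  linarith

theorem one_sub_inv_sq_mem_Icc {k : ℕ} (hk : 3 ≤ k) :
    1 - 1 / ((k : ℝ) - 1) ^ 2 ∈ Set.Icc (0 : ℝ) 1 := by
  have hk' : (3 : ℝ) ≤ k := by exact_mod_cast hk
  have h : 1 ≤ ((k : ℝ) - 1) ^ 2 := by nlinarith
  exact ⟨sub_nonneg.2 ((div_le_one (by linarith)).2 h), sub_le_self _ (by positivity)⟩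

theorem half_le_prod_one_sub_inv_sq {s : Finset ℕ} (hs : ∀ k ∈ s, 3 ≤ k) :
    (1 / 2 : ℝ) ≤ ∏ k ∈ s, (1 - 1 / ((k : ℝ) - 1) ^ 2) := by
  have hsub : s ⊆ Ico 3 (s.sup id + 3) := fun k hk => by
    have := le_sup (f := id) hk
    simp only [id, mem_Ico] at this ⊢
    exact ⟨hs k hk, by omega⟩
  refine (half_le_prod_Ico_one_sub_inv_sq (s.sup id)).trans ?_
  rw [← prod_sdiff hsub]
  refine mul_le_of_le_one_left
    (prod_nonneg fun k hk => (one_sub_inv_sq_mem_Icc (hs k hk)).1) ?_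
  have h3 : ∀ k ∈ Ico 3 (s.sup id + 3) \ s, 3 ≤ k := fun k hk =>
    (mem_Ico.1 (mem_sdiff.1 hk).1).1
  exact prod_le_one (fun k hk => (one_sub_inv_sq_mem_Icc (h3 k hk)).1)
    fun k hk => (one_sub_inv_sq_mem_Icc (h3 k hk)).2

theorem one_le_tprod_one_add_le_exp_tsum {ι : Type*} {f : ι → ℝ} (hf : ∀ i, 0 ≤ f i)
    (hs : Summable f) :
    1 ≤ ∏' i, (1 + f i) ∧ ∏' i, (1 + f i) ≤ Real.exp (∑' i, f i) := by
  have hm : HasProd (fun i => 1 + f i) (∏' i, (1 + f i)) :=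
    (Real.multipliable_one_add_of_summable hs).hasProd
  refine ⟨ge_of_tendsto' hm fun s => ?_, le_of_tendsto' hm fun s => ?_⟩
  · simpa using prod_le_prod (s := s) (f := fun _ => (1 : ℝ)) (fun _ _ => zero_le_one)
      fun i _ => le_add_of_nonneg_right (hf i)
  · calc ∏ i ∈ s, (1 + f i) ≤ ∏ i ∈ s, Real.exp (f i) :=
          prod_le_prod (fun i _ => by linarith [hf i])
            fun i _ => by linarith [Real.add_one_le_exp (f i)]
      _ = Real.exp (∑ i ∈ s, f i) := (Real.exp_sum s f).symm
      _ ≤ Real.exp (∑' i, f i) := Real.exp_le_exp.2 (hs.sum_le_tsum s fun i _ => hf i)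

theorem summable_inv_pred_cube : Summable fun n : ℕ => 1 / ((n - 1 : ℕ) : ℝ) ^ 3 := by
  rw [← summable_nat_add_iff 1]
  simp

theorem stmt5 :
    ∃ c₁ > (0 : ℝ), ∃ c₂ > (0 : ℝ), ∀ N : ℕ, 0 < N → Even N →
      c₁ < singularD N ∧ singularD N < c₂ := by
  set g : ℕ → ℝ := fun n => 1 / ((n - 1 : ℕ) : ℝ) ^ 3 with hg
  have hg0 : ∀ n, 0 ≤ g n := fun n => by positivity
  refine ⟨1 / 2, by norm_num, 2 * Real.exp (∑' n, g n) + 1, by positivity, fun N _ _ => ?_⟩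
  have h3 : ∀ p ∈ N.primeFactors.filter (fun p => Odd p), 3 ≤ p := fun p hp => by
    obtain ⟨hp, k, rfl⟩ := mem_filter.1 hp
    have := (Nat.prime_of_mem_primeFactors hp).two_le
    omega
  have hA := half_le_prod_one_sub_inv_sq h3
  have hA1 := prod_le_one (fun k hk => (one_sub_inv_sq_mem_Icc (h3 k hk)).1)
    fun k hk => (one_sub_inv_sq_mem_Icc (h3 k hk)).2
  have hinj : Function.Injective fun p : {p : Nat.Primes // ¬ ((p : ℕ) ∣ N)} => (p.1 : ℕ) :=
    Nat.Primes.coe_nat_injective.comp Subtype.val_injective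
  have hterm : ∀ p : {p : Nat.Primes // ¬ ((p : ℕ) ∣ N)},
      1 / (((p.1 : ℕ) : ℝ) - 1) ^ 3 = g (p.1 : ℕ) := fun p => by
    simp only [hg, Nat.cast_pred p.1.2.pos]
  have hs := summable_inv_pred_cube.comp_injective hinj
  obtain ⟨hB, hB'⟩ := one_le_tprod_one_add_le_exp_tsum (fun p => hg0 _) hs
  have hC : ∑' p : {p : Nat.Primes // ¬ ((p : ℕ) ∣ N)}, g (p.1 : ℕ) ≤ ∑' n, g n :=
    hs.tsum_le_tsum_of_inj _ hinj (fun n _ => hg0 n) (fun _ => le_rfl) summable_inv_pred_cube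
  have hBC := hB'.trans (Real.exp_le_exp.2 hC)
  simp only [singularD, hterm]
  change 1 ≤ ∏' p : {p : Nat.Primes // ¬ ((p : ℕ) ∣ N)}, (1 + g (p.1 : ℕ)) at hB
  change ∏' p : {p : Nat.Primes // ¬ ((p : ℕ) ∣ N)}, (1 + g (p.1 : ℕ)) ≤ _ at hBC
  constructor <;> nlinarith
end

section
/- Fix λ > 0 and ε ∈ (0,1). Set A = N·e^{-ε√(log N)}, Q = (log N)^λ, τ = A²·N^{-1}·Q^{-1}, let 𝔐 be the union over 1 ≤ q ≤ Q and 0 ≤ a ≤ q−1 with gcd(a,q)=1 of the intervals {α ∈ [−1/τ, 1−1/τ] : |α − a/q| ≤ 1/τ}, and let m = [−1/τ, 1−1/τ] \ 𝔐 be the minor arcs. Then if α ∈ m, the exponential sum satisfies F̃(α,A) ≪ A / (log N)^{λ/2 − 4}, for all sufficiently large even N. -/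
open Finset Real
open scoped BigOperators Classical

/-- `A = N·e^{−ε√(log N)}`. -/
noncomputable def Aof (ε : ℝ) (N : ℕ) : ℝ := (N : ℝ) * Real.exp (-ε * Real.sqrt (Real.log N))

/-- `Q = (log N)^λ`. -/
noncomputable def Qof (lam : ℝ) (N : ℕ) : ℝ := Real.log N ^ (lam : ℝ)

/-- `τ = A²·N⁻¹·Q⁻¹`. -/
noncomputable def tauof (ε lam : ℝ) (N : ℕ) : ℝ := Aof ε N ^ 2 * (N : ℝ)⁻¹ * (Qof lam N)⁻¹

/-- The major arcs: all `α ∈ [−1/τ, 1−1/τ]` with `|α − a/q| ≤ 1/τ` for some `1 ≤ q ≤ Q`,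
`0 ≤ a ≤ q−1`, `gcd(a,q) = 1`. -/
noncomputable def Major (ε lam : ℝ) (N : ℕ) : Set ℝ :=
  {α : ℝ | α ∈ Set.Icc (-(1 / tauof ε lam N)) (1 - 1 / tauof ε lam N) ∧
    ∃ q a : ℕ, 1 ≤ q ∧ (q : ℝ) ≤ Qof lam N ∧ a < q ∧ Nat.gcd a q = 1 ∧
      |α - (a : ℝ) / q| ≤ 1 / tauof ε lam N}

/-- The minor arcs `m = [−1/τ, 1−1/τ] \ 𝔐`. -/
noncomputable def Minor (ε lam : ℝ) (N : ℕ) : Set ℝ :=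
  Set.Icc (-(1 / tauof ε lam N)) (1 - 1 / tauof ε lam N) \ Major ε lam N

/-- `F̃(α,A) = Σ_{2 < p ≤ A} (log p)·e(α·2p)`, sum over primes `p`. -/
noncomputable def Ftilde (A α : ℝ) : ℂ :=
  ∑ p ∈ (Finset.range (⌊A⌋₊ + 1)).filter
      (fun p => Nat.Prime p ∧ 2 < p ∧ (p : ℝ) ≤ A),
    (Real.log p : ℂ) * e (α * (2 * p))

theorem e_add (s t : ℝ) : e (s + t) = e s * e t := by
  simp only [e, ← Complex.exp_add]; congr 1; push_cast; ring

theorem norm_e (t : ℝ) : ‖e t‖ = 1 := by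
  have : e t = Complex.exp (((2 * π * t : ℝ) : ℂ) * Complex.I) := by
    simp only [e]; congr 1; push_cast; ring
  rw [this, Complex.norm_exp_ofReal_mul_I]

theorem e_intCast (n : ℤ) : e n = 1 := by
  have : e n = Complex.exp (n * (2 * π * Complex.I)) := by
    simp only [e]; congr 1; push_cast; ring
  rw [this, Complex.exp_int_mul_two_pi_mul_I]

theorem e_natCast_mul (n : ℕ) (t : ℝ) : e (n * t) = e t ^ n := by
  simp only [e, ← Complex.exp_nat_mul]; congr 1; push_cast; ring

theorem conj_e (t : ℝ) : (starRingEnd ℂ) (e t) = e (-t) := by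
  simp only [e, ← Complex.exp_conj]; congr 1; simp [map_ofNat (starRingEnd ℂ) 2]

theorem abs_sub_round_le_norm_e_sub_one (x : ℝ) : 4 * |x - round x| ≤ ‖e x - 1‖ := by
  set y := x - round x with hy
  have hxy : e x = e y := by
    have : x = y + (round x : ℤ) := by simp [hy]
    conv_lhs => rw [this, e_add, e_intCast, mul_one]
  have hy2 : |y| ≤ 1 / 2 := abs_sub_round x
  have hey : e y = Complex.exp (Complex.I * ((2 * π * y : ℝ) : ℂ)) := by
    simp only [e]; congr 1; push_cast; ring
  rw [hxy, hey, Complex.norm_exp_I_mul_ofReal_sub_one, norm_mul, Real.norm_eq_abs, Real.norm_eq_abs,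
    show 2 * π * y / 2 = π * y by ring]
  have h1 : |sin (π * y)| = sin (π * |y|) := by
    rcases le_total 0 y with h | h
    · rw [abs_of_nonneg h, abs_of_nonneg]
      apply sin_nonneg_of_nonneg_of_le_pi (by positivity)
      rw [abs_of_nonneg h] at hy2; nlinarith [pi_pos]
    · rw [abs_of_nonpos h, mul_neg, sin_neg, abs_of_nonpos]
      rw [abs_of_nonpos h] at hy2
      apply sin_nonpos_of_nonpos_of_neg_pi_le
      · nlinarith [pi_pos]
      · nlinarith [pi_pos]
  have h2 := mul_le_sin (x := π * |y|) (by positivity) (by nlinarith [pi_pos])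
  rw [h1, abs_two]
  have : 2 / π * (π * |y|) = 2 * |y| := by field_simp
  linarith

theorem norm_sum_e_mul_abs_sub_round_le (x : ℝ) (a b : ℕ) :
    ‖∑ m ∈ Ico a b, e (m * x)‖ * |x - round x| ≤ 1 := by
  rcases le_total b a with hab | hab
  · simp [Finset.Ico_eq_empty_of_le hab]
  have hg : (∑ m ∈ Ico a b, e (m * x)) * (e x - 1) = e x ^ b - e x ^ a := by
    simp only [e_natCast_mul]
    exact geom_sum_Ico_mul _ hab
  have h1 : ‖∑ m ∈ Ico a b, e (m * x)‖ * ‖e x - 1‖ ≤ 2 := by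
    rw [← norm_mul, hg]
    refine (norm_sub_le _ _).trans ?_
    simp [norm_e]; norm_num
  have h2 := abs_sub_round_le_norm_e_sub_one x
  nlinarith [norm_nonneg (∑ m ∈ Ico a b, e (m * x))]

theorem norm_sum_e_le_card (s : Finset ℕ) (f : ℕ → ℝ) : ‖∑ m ∈ s, e (f m)‖ ≤ #s := by
  refine (norm_sum_le _ _).trans ?_
  simp [norm_e]

/-- A sum over a block of q consecutive frequencies, each term being at most X and at most the
reciprocal of the distance of β r + γ to the nearest integer. -/
theorem sum_range_le_of_approx {β : ℝ} {q : ℕ} {a : ℤ} (hq : 0 < q) (haq : IsCoprime a (q : ℤ))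
    (hβ : |β - a / q| ≤ 1 / (q : ℝ) ^ 2) (γ X : ℝ) (c : ℕ → ℝ)
    (hc0 : ∀ r < q, 0 ≤ c r) (hcX : ∀ r < q, c r ≤ X)
    (hc : ∀ r < q, c r * |(β * r + γ) - round (β * r + γ)| ≤ 1) :
    ∑ r ∈ range q, c r ≤ 6 * (X + q) * (1 + Real.log q) := by
  have hqR : (0 : ℝ) < q := by exact_mod_cast hq
  have hqZ : (0 : ℤ) < q := by exact_mod_cast hq
  have hX : 0 ≤ X := (hc0 0 hq).trans (hcX 0 hq)
  set s : ℤ := ⌊q * γ⌋ with hs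
  let u : ℕ → ℕ := fun r => ((s + a * r) % q).toNat
  have hu : ∀ r, ((u r : ℕ) : ℤ) = (s + a * r) % q := fun r =>
    Int.toNat_of_nonneg (Int.emod_nonneg _ hqZ.ne')
  have hulast : ∀ r, u r < q := fun r => by
    have := Int.emod_lt_of_pos (s + a * r) hqZ
    have := hu r
    omega
  have hinj : Set.InjOn u (range q : Finset ℕ) := by
    intro r hr r' hr' h
    simp only [coe_range, Set.mem_Iio] at hr hr'
    have h1 : (s + a * r) % q = (s + a * r') % q := by rw [← hu, ← hu, h]
    have h2 : (q : ℤ) ∣ a * (r' - r) := by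
      have := Int.ModEq.dvd h1
      convert this using 1; ring
    have h3 : (q : ℤ) ∣ (r' - r) := haq.symm.dvd_of_dvd_mul_left h2
    have h4 : ((r' : ℤ) - r) = 0 := Int.eq_zero_of_abs_lt_dvd h3 (by rw [abs_lt]; omega)
    omega
  have key : ∀ r < q, c r ≤ (q + 3 * X) * (1 / ((u r : ℝ) + 1) + 1 / ((q : ℝ) - u r)) := by
    intro r hr
    set n : ℤ := round (β * r + γ) with hn
    have herr : |(q : ℝ) * (β * r + γ) - (s + a * r)| ≤ 2 := by
      have h1 : |(q : ℝ) * γ - s| ≤ 1 := by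
        have h5 := Int.floor_le ((q : ℝ) * γ)
        have h6 := Int.lt_floor_add_one ((q : ℝ) * γ)
        rw [abs_le]; constructor <;> linarith
      have h2 : |(q : ℝ) * β * r - a * r| ≤ 1 := by
        have : (q : ℝ) * β * r - a * r = q * r * (β - a / q) := by field_simp
        rw [this, abs_mul, abs_of_nonneg (by positivity)]
        have hrq : (r : ℝ) ≤ q := by exact_mod_cast hr.le
        calc (q : ℝ) * r * |β - a / q| ≤ q * q * (1 / (q : ℝ) ^ 2) := by gcongr
          _ = 1 := by field_simp
      have : (q : ℝ) * (β * r + γ) - (s + a * r) = (q * β * r - a * r) + (q * γ - s) := by ring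
      rw [this]
      exact (abs_add_le _ _).trans (by linarith)
    obtain ⟨t, ht⟩ : ∃ t : ℤ, s + a * r - q * n = u r + q * t :=
      ⟨(s + a * r) / q - n, by rw [hu]; linarith [Int.emod_add_mul_ediv (s + a * r) q]⟩
    have hulq := hulast r
    have hmin : min (u r : ℝ) (q - u r) ≤ |((u r : ℝ) + q * t)| := by
      rcases le_or_gt 0 t with h0 | h0
      · have : (0 : ℝ) ≤ t := by exact_mod_cast h0
        exact (min_le_left _ _).trans (le_trans (by nlinarith) (le_abs_self _))
      · have : (t : ℝ) ≤ -1 := by exact_mod_cast (by omega : t ≤ -1)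
        exact (min_le_right _ _).trans (le_trans (by nlinarith) (neg_le_abs _))
    have hdist : min (u r : ℝ) (q - u r) - 2 ≤ q * |(β * r + γ) - n| := by
      have htR : (s : ℝ) + a * r - q * n = u r + q * t := by exact_mod_cast ht
      rw [← htR] at hmin
      have h7 : (q : ℝ) * |(β * r + γ) - n| = |q * ((β * r + γ) - n)| := by
        rw [abs_mul, abs_of_pos hqR]
      rw [h7]
      have h8 : (s : ℝ) + a * r - q * n
        = (q * ((β * r + γ) - n)) - ((q : ℝ) * (β * r + γ) - (s + a * r)) := by ring
      rw [h8] at hmin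
      have := abs_sub ((q : ℝ) * ((β * r + γ) - n)) ((q : ℝ) * (β * r + γ) - (s + a * r))
      linarith
    have hcr := hc r hr
    have hc0r := hc0 r hr
    have hcXr := hcX r hr
    have hmain : c r * (min (u r : ℝ) (q - u r) + 1) ≤ q + 3 * X := by
      have h9 : c r * (min (u r : ℝ) (q - u r) - 2) ≤ q := by
        calc c r * (min (u r : ℝ) (q - u r) - 2) ≤ c r * (q * |(β * r + γ) - n|) := by gcongr
          _ = q * (c r * |(β * r + γ) - n|) := by ring
          _ ≤ q * 1 := by gcongr
          _ = q := mul_one _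
      nlinarith
    have hu1 : (0 : ℝ) ≤ u r := by positivity
    have hu2 : (1 : ℝ) ≤ q - u r := by
      have : (u r : ℝ) + 1 ≤ q := by exact_mod_cast hulq
      linarith
    rw [mul_add]
    have hY : 0 ≤ q + 3 * X := by positivity
    rcases le_total (u r : ℝ) (q - u r) with h | h
    · rw [min_eq_left h] at hmain
      have : c r ≤ (q + 3 * X) * (1 / ((u r : ℝ) + 1)) := by
        rw [mul_one_div, le_div_iff₀ (by positivity)]; exact hmain
      have : 0 ≤ (q + 3 * X) * (1 / ((q : ℝ) - u r)) := by positivity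
      linarith
    · rw [min_eq_right h] at hmain
      have : c r ≤ (q + 3 * X) * (1 / ((q : ℝ) - u r)) := by
        rw [mul_one_div, le_div_iff₀ (by linarith)]; nlinarith
      have : 0 ≤ (q + 3 * X) * (1 / ((u r : ℝ) + 1)) := by positivity
      linarith
  have hH : ∑ v ∈ range q, 1 / ((v : ℝ) + 1) ≤ 1 + Real.log q := by
    have := harmonic_le_one_add_log q
    rw [harmonic] at this
    push_cast at this
    simpa [one_div] using this
  have hH' : ∑ v ∈ range q, 1 / ((q : ℝ) - v) = ∑ v ∈ range q, 1 / ((v : ℝ) + 1) := by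
    rw [← Finset.sum_range_reflect]
    refine Finset.sum_congr rfl fun v hv => ?_
    rw [Finset.mem_range] at hv
    rw [Nat.cast_sub (by omega), Nat.cast_sub (by omega)]
    congr 1; push_cast; ring
  have hY : 0 ≤ q + 3 * X := by positivity
  calc ∑ r ∈ range q, c r
      ≤ ∑ r ∈ range q, (q + 3 * X) * (1 / ((u r : ℝ) + 1) + 1 / ((q : ℝ) - u r)) :=
        Finset.sum_le_sum fun r hr => key r (Finset.mem_range.1 hr)
    _ = ∑ v ∈ (range q).image u, (q + 3 * X) * (1 / ((v : ℝ) + 1) + 1 / ((q : ℝ) - v)) := by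
        rw [Finset.sum_image hinj]
    _ ≤ ∑ v ∈ range q, (q + 3 * X) * (1 / ((v : ℝ) + 1) + 1 / ((q : ℝ) - v)) := by
        refine Finset.sum_le_sum_of_subset_of_nonneg ?_ ?_
        · intro v hv
          obtain ⟨r, -, rfl⟩ := Finset.mem_image.1 hv
          exact Finset.mem_range.2 (hulast r)
        · intro v hv _
          have : (v : ℝ) < q := by exact_mod_cast Finset.mem_range.1 hv
          have : 0 < (q : ℝ) - v := by linarith
          positivity
    _ = (q + 3 * X) * (2 * ∑ v ∈ range q, 1 / ((v : ℝ) + 1)) := by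
        rw [← Finset.mul_sum, Finset.sum_add_distrib, hH']; ring
    _ ≤ (q + 3 * X) * (2 * (1 + Real.log q)) := by gcongr
    _ ≤ 6 * (X + q) * (1 + Real.log q) := by
        have : 0 ≤ Real.log q := Real.log_natCast_nonneg q
        nlinarith [mul_nonneg hqR.le this]

theorem sum_range_mul_le_of_approx {β : ℝ} {q : ℕ} {a : ℤ} (hq : 0 < q)
    (haq : IsCoprime a (q : ℤ)) (hβ : |β - a / q| ≤ 1 / (q : ℝ) ^ 2) (γ : ℝ) (X : ℕ → ℝ) (J : ℕ)
    (c : ℕ → ℝ) (hc0 : ∀ r, 0 ≤ c r) (hcX : ∀ r, c r ≤ X (r / q))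
    (hc : ∀ r, c r * |(β * r + γ) - round (β * r + γ)| ≤ 1) :
    ∑ r ∈ range (q * J), c r ≤ ∑ j ∈ range J, 6 * (X j + q) * (1 + Real.log q) := by
  induction J with
  | zero => simp
  | succ J ih =>
    rw [Nat.mul_succ, Finset.sum_range_add, Finset.sum_range_succ]
    refine add_le_add ih ?_
    refine sum_range_le_of_approx hq haq hβ (β * (q * J) + γ) (X J) (fun r => c (q * J + r))
      (fun r _ => hc0 _) (fun r hr => ?_) (fun r _ => ?_)
    · have : (q * J + r) / q = J := by
        rw [Nat.mul_add_div hq, Nat.div_eq_of_lt hr, add_zero]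
      simpa only [this] using hcX (q * J + r)
    · have := hc (q * J + r)
      have h2 : β * ((q * J + r : ℕ) : ℝ) + γ = β * r + (β * (q * J) + γ) := by push_cast; ring
      rwa [h2] at this

theorem sum_range_le_of_approx_of_le {β : ℝ} {q : ℕ} {a : ℤ} (hq : 0 < q)
    (haq : IsCoprime a (q : ℤ)) (hβ : |β - a / q| ≤ 1 / (q : ℝ) ^ 2) (γ X : ℝ) (hX : 0 ≤ X) (n : ℕ)
    (c : ℕ → ℝ) (hc0 : ∀ r < n, 0 ≤ c r) (hcX : ∀ r < n, c r ≤ X)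
    (hc : ∀ r < n, c r * |(β * r + γ) - round (β * r + γ)| ≤ 1) :
    ∑ r ∈ range n, c r ≤ ((n : ℝ) / q + 1) * (6 * (X + q) * (1 + Real.log q)) := by
  have hqR : (0 : ℝ) < q := by exact_mod_cast hq
  set c' : ℕ → ℝ := fun r => if r < n then c r else 0 with hc'
  have hn : n ≤ q * (n / q + 1) := (Nat.lt_mul_div_succ n hq).le
  have hlog : 0 ≤ Real.log q := Real.log_natCast_nonneg q
  have hc'0 : ∀ r, 0 ≤ c' r := fun r => by
    simp only [hc']; split_ifs with h
    exacts [hc0 r h, le_rfl]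
  calc ∑ r ∈ range n, c r = ∑ r ∈ range n, c' r :=
        Finset.sum_congr rfl fun r hr => by simp [hc', Finset.mem_range.1 hr]
    _ ≤ ∑ r ∈ range (q * (n / q + 1)), c' r :=
        Finset.sum_le_sum_of_subset_of_nonneg (Finset.range_subset_range.2 hn) fun r _ _ => hc'0 r
    _ ≤ ∑ j ∈ range (n / q + 1), 6 * (X + q) * (1 + Real.log q) := by
        refine sum_range_mul_le_of_approx hq haq hβ γ (fun _ => X) _ c' hc'0 (fun r => ?_)
          (fun r => ?_)
        · simp only [hc']; split_ifs with h
          exacts [hcX r h, hX]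
        · simp only [hc']; split_ifs with h
          exacts [hc r h, by simp]
    _ ≤ ((n : ℝ) / q + 1) * (6 * (X + q) * (1 + Real.log q)) := by
        rw [Finset.sum_const, Finset.card_range, nsmul_eq_mul]
        have : ((n / q : ℕ) : ℝ) ≤ (n : ℝ) / q := Nat.cast_div_le
        push_cast
        gcongr

theorem one_le_two_mul_mul_abs_sub_round {β : ℝ} {q : ℕ} {a : ℤ} (haq : IsCoprime a (q : ℤ))
    (hβ : |β - a / q| ≤ 1 / (q : ℝ) ^ 2) {k : ℕ} (hk : 0 < k) (hkq : 2 * k ≤ q) :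
    1 ≤ 2 * q * |β * k - round (β * k)| := by
  set n := round (β * k)
  have hq : 0 < q := by omega
  have hqR : (0 : ℝ) < q := by exact_mod_cast hq
  have h1 : (1 : ℝ) ≤ |(a : ℝ) * k - q * n| := by
    have : a * k - q * n ≠ 0 := by
      intro h
      have h2 : (q : ℤ) ∣ a * k := ⟨n, by linarith⟩
      have h3 : (q : ℤ) ∣ k := haq.symm.dvd_of_dvd_mul_left h2
      have := Nat.le_of_dvd hk (by exact_mod_cast h3)
      omega
    exact_mod_cast Int.one_le_abs this
  have h2 : |(q : ℝ) * β * k - a * k| ≤ 1 / 2 := by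
    have : (q : ℝ) * β * k - a * k = q * k * (β - a / q) := by field_simp
    rw [this, abs_mul, abs_of_nonneg (by positivity)]
    have hrq : (k : ℝ) ≤ q / 2 := by
      have : (2 : ℝ) * k ≤ q := by exact_mod_cast hkq
      linarith
    calc (q : ℝ) * k * |β - a / q| ≤ q * (q / 2) * (1 / (q : ℝ) ^ 2) := by gcongr
      _ = 1 / 2 := by field_simp
  have h3 : (a : ℝ) * k - q * n = q * (β * k - n) - (q * β * k - a * k) := by ring
  rw [h3] at h1
  have h4 := abs_sub (q * (β * k - n)) (q * β * k - a * k)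
  rw [abs_mul, abs_of_pos hqR] at h4
  linarith

theorem sum_Ioc_le_of_approx {β : ℝ} {q x : ℕ} {a : ℤ} (hq : 0 < q)
    (haq : IsCoprime a (q : ℤ)) (hβ : |β - a / q| ≤ 1 / (q : ℝ) ^ 2) (hqx : q ≤ x) {K : ℕ}
    (hK : K ≤ x) (c : ℕ → ℝ) (hc0 : ∀ k, 0 ≤ c k) (hcX : ∀ k, 0 < k → c k ≤ x / k)
    (hc : ∀ k, c k * |β * k - round (β * k)| ≤ 1) :
    ∑ k ∈ Ioc 0 K, c k ≤
      6 * (1 + Real.log x) * (3 * K + 3 * q + 4 * (x / q) * (1 + Real.log x)) := by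
  have hqR : (0 : ℝ) < q := by exact_mod_cast hq
  have hxR : (1 : ℝ) ≤ x := by exact_mod_cast (by omega : 1 ≤ x)
  set c' : ℕ → ℝ := fun r => if 0 < r then c r else 0 with hc'
  have hc'0 : ∀ r, 0 ≤ c' r := fun r => by
    simp only [hc']; split_ifs with h
    exacts [hc0 r, le_rfl]
  set J := K / q + 1 with hJ
  have hn : K < q * J := Nat.lt_mul_div_succ K hq
  have hL : 0 ≤ Real.log q := Real.log_natCast_nonneg q
  have hLq : Real.log q ≤ Real.log x := Real.log_le_log hqR (by exact_mod_cast hqx)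
  have hJK : (J : ℝ) ≤ K / q + 1 := by
    rw [hJ]; push_cast
    have : ((K / q : ℕ) : ℝ) ≤ (K : ℝ) / q := Nat.cast_div_le
    linarith
  have hH : ∑ j ∈ range J, 1 / ((j : ℝ) + 1) ≤ 2 * (1 + Real.log x) := by
    have h1 := harmonic_le_one_add_log J
    rw [harmonic] at h1
    push_cast at h1
    have h2 : Real.log J ≤ Real.log (2 * x) := by
      refine Real.log_le_log (by rw [hJ]; positivity) ?_
      have : J ≤ 2 * x := by
        have := Nat.div_le_self K q
        omega
      exact_mod_cast this
    rw [Real.log_mul (by norm_num) (by positivity)] at h2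
    have h3 : Real.log 2 < 1 := by linarith [Real.log_two_lt_d9]
    have h4 : 0 ≤ Real.log x := Real.log_nonneg hxR
    simp only [one_div]
    linarith
  calc ∑ k ∈ Ioc 0 K, c k = ∑ k ∈ Ioc 0 K, c' k :=
        Finset.sum_congr rfl fun r hr => by simp [hc', (Finset.mem_Ioc.1 hr).1]
    _ ≤ ∑ k ∈ range (q * J), c' k := by
        refine Finset.sum_le_sum_of_subset_of_nonneg ?_ fun r _ _ => hc'0 r
        intro k hk
        simp only [Finset.mem_Ioc, Finset.mem_range] at hk ⊢
        omega
    _ ≤ ∑ j ∈ range J, 6 * ((2 * q + 2 * x / q * (1 / ((j : ℝ) + 1))) + q) * (1 + Real.log q) := by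
        refine sum_range_mul_le_of_approx hq haq hβ 0
          (fun j => 2 * q + 2 * x / q * (1 / ((j : ℝ) + 1))) J c' hc'0 (fun r => ?_) (fun r => ?_)
        · simp only [hc']; split_ifs with h
          · rcases le_or_gt (2 * r) q with h2 | h2
            · have h3 := one_le_two_mul_mul_abs_sub_round haq hβ h h2
              have h4 := hc r
              have h5 := hc0 r
              have h6 : c r ≤ 2 * q := by
                calc c r = c r * 1 := (mul_one _).symm
                  _ ≤ c r * (2 * q * |β * r - round (β * r)|) := by gcongr
                  _ = 2 * q * (c r * |β * r - round (β * r)|) := by ring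
                  _ ≤ 2 * q * 1 := by gcongr
                  _ = 2 * q := mul_one _
              have : 0 ≤ 2 * (x : ℝ) / q * (1 / (((r / q : ℕ) : ℝ) + 1)) := by positivity
              linarith
            · refine (hcX r h).trans ?_
              have h3 : (r / q + 1) * q ≤ 2 * r := by
                have h7 := Nat.div_mul_le_self r q
                rcases Nat.eq_zero_or_pos (r / q) with h8 | h8
                · rw [h8]; omega
                · have : 1 * q ≤ r / q * q := Nat.mul_le_mul_right _ h8
                  rw [add_mul]; omega
              have h4 : (((r / q : ℕ) : ℝ) + 1) * q ≤ 2 * r := by exact_mod_cast h3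
              have hr : (0 : ℝ) < r := by exact_mod_cast h
              have h5 : (x : ℝ) / r ≤ 2 * x / q * (1 / (((r / q : ℕ) : ℝ) + 1)) := by
                rw [div_mul_div_comm, mul_one, div_le_div_iff₀ hr (by positivity)]
                nlinarith
              linarith
          · positivity
        · simp only [hc', add_zero]; split_ifs with h
          exacts [hc r, by simp]
    _ = 6 * (1 + Real.log q) * (3 * q * J + 2 * x / q * ∑ j ∈ range J, 1 / ((j : ℝ) + 1)) := by
        simp only [← Finset.sum_mul, ← Finset.mul_sum, Finset.sum_add_distrib, Finset.sum_const,
          Finset.card_range, nsmul_eq_mul]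
        ring
    _ ≤ 6 * (1 + Real.log x) *
          (3 * q * (K / q + 1) + 2 * x / q * (2 * (1 + Real.log x))) := by
        gcongr
    _ = _ := by field_simp; ring

theorem norm_sum_log_mul_le (g : ℕ → ℂ) (B : ℝ) (n : ℕ)
    (hB : ∀ k ≤ n, ‖∑ m ∈ Ioc 0 k, g m‖ ≤ B) :
    ‖∑ m ∈ Ioc 0 n, (Real.log m : ℂ) * g m‖ ≤ 2 * Real.log n * B := by
  have key : ∀ k ≤ n, ‖∑ m ∈ Ioc 0 k, (Real.log m : ℂ) * g m
      - (Real.log k : ℂ) * ∑ m ∈ Ioc 0 k, g m‖ ≤ Real.log k * B := by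
    intro k
    induction k with
    | zero => simp
    | succ k ih =>
      intro hk
      have ih' := ih (by omega)
      have hBk := hB k (by omega)
      rw [Finset.sum_Ioc_succ_top (by omega), Finset.sum_Ioc_succ_top (by omega)]
      have hmono : Real.log k ≤ Real.log (k + 1 : ℕ) := by
        rcases Nat.eq_zero_or_pos k with h | h
        · simp [h]
        · exact Real.log_le_log (by exact_mod_cast h) (by push_cast; linarith)
      set S := ∑ m ∈ Ioc 0 k, (Real.log m : ℂ) * g m
      set G := ∑ m ∈ Ioc 0 k, g m
      have : S + (Real.log (k + 1 : ℕ) : ℂ) * g (k + 1) -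
            (Real.log (k + 1 : ℕ) : ℂ) * (G + g (k + 1))
          = (S - (Real.log k : ℂ) * G) - ((Real.log (k + 1 : ℕ) - Real.log k : ℝ) : ℂ) * G := by
        push_cast; ring
      rw [this]
      refine (norm_sub_le _ _).trans ?_
      rw [norm_mul, Complex.norm_real, Real.norm_of_nonneg (by linarith)]
      have : (Real.log (k + 1 : ℕ) - Real.log k) * ‖G‖ ≤ (Real.log (k + 1 : ℕ) - Real.log k) * B :=
        mul_le_mul_of_nonneg_left hBk (by linarith)
      linarith
  have h1 := key n le_rfl
  have h2 := hB n le_rfl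
  have hn : 0 ≤ Real.log n := Real.log_natCast_nonneg n
  have h3 := norm_le_norm_sub_add (∑ m ∈ Ioc 0 n, (Real.log m : ℂ) * g m)
    ((Real.log n : ℂ) * ∑ m ∈ Ioc 0 n, g m)
  rw [norm_mul, Complex.norm_real, Real.norm_of_nonneg hn] at h3
  have := mul_le_mul_of_nonneg_left h2 hn
  linarith

theorem norm_sum_Ioc_e_mul_abs_sub_round_le (x : ℝ) (n : ℕ) :
    ‖∑ m ∈ Ioc 0 n, e (m * x)‖ * |x - round x| ≤ 1 := by
  have : Ioc 0 n = Ico 1 (n + 1) := by ext; simp; omega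
  rw [this]
  exact norm_sum_e_mul_abs_sub_round_le x 1 (n + 1)

theorem norm_sum_Ioc_e_le {x k n : ℕ} (t : ℝ) (h : n ≤ x / k) :
    ‖∑ m ∈ Ioc 0 n, e (m * t)‖ ≤ (x : ℝ) / k := by
  refine (norm_sum_e_le_card (Ioc 0 n) fun m => m * t).trans ?_
  rw [Nat.card_Ioc, Nat.sub_zero]
  exact (Nat.cast_le.2 h).trans Nat.cast_div_le

theorem sum_norm_sum_e_le {β : ℝ} {q x : ℕ} {a : ℤ} (hq : 0 < q)
    (haq : IsCoprime a (q : ℤ)) (hβ : |β - a / q| ≤ 1 / (q : ℝ) ^ 2) (hqx : q ≤ x) {K : ℕ}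
    (hK : K ≤ x) :
    ∑ k ∈ Ioc 0 K, ‖∑ m ∈ Ioc 0 (x / k), e (m * (β * k))‖ ≤
      6 * (1 + Real.log x) * (3 * K + 3 * q + 4 * (x / q) * (1 + Real.log x)) :=
  sum_Ioc_le_of_approx hq haq hβ hqx hK _ (fun _ => norm_nonneg _)
    (fun _ _ => norm_sum_Ioc_e_le _ le_rfl)
    (fun _ => norm_sum_Ioc_e_mul_abs_sub_round_le _ _)

theorem log_natCast_div_le (n k : ℕ) : Real.log (n / k : ℕ) ≤ Real.log n := by
  rcases Nat.eq_zero_or_pos (n / k) with h | h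
  · rw [h]; simpa using Real.log_natCast_nonneg n
  · exact Real.log_le_log (by exact_mod_cast h) (by exact_mod_cast Nat.div_le_self n k)

theorem sum_norm_sum_log_mul_e_le {β : ℝ} {q x : ℕ} {a : ℤ} (hq : 0 < q)
    (haq : IsCoprime a (q : ℤ)) (hβ : |β - a / q| ≤ 1 / (q : ℝ) ^ 2) (hqx : q ≤ x) {K : ℕ}
    (hK : K ≤ x) :
    ∑ k ∈ Ioc 0 K, ‖∑ m ∈ Ioc 0 (x / k), (Real.log m : ℂ) * e (m * (β * k))‖ ≤
      2 * (1 + Real.log x) *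
        (6 * (1 + Real.log x) * (3 * K + 3 * q + 4 * (x / q) * (1 + Real.log x))) := by
  have hx : (1 : ℝ) ≤ x := by exact_mod_cast (by omega : 1 ≤ x)
  have hlx : 0 ≤ Real.log x := Real.log_nonneg hx
  have hL : 0 < 2 * (1 + Real.log x) := by positivity
  have hlog : ∀ k : ℕ, 2 * Real.log (x / k : ℕ) ≤ 2 * (1 + Real.log x) := by
    intro k
    linarith [log_natCast_div_le x k]
  have h := sum_Ioc_le_of_approx hq haq hβ hqx hK
    (fun k => ‖∑ m ∈ Ioc 0 (x / k), (Real.log m : ℂ) * e (m * (β * k))‖ / (2 * (1 + Real.log x)))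
    (fun _ => by positivity) (fun k _ => ?_) (fun k => ?_)
  · rw [← Finset.sum_div, div_le_iff₀ hL] at h
    linarith
  · rw [div_le_iff₀ hL, mul_comm ((x : ℝ) / k)]
    refine (norm_sum_log_mul_le (fun m => e (m * (β * k))) ((x : ℝ) / k) (x / k)
      fun j hj => norm_sum_Ioc_e_le _ hj).trans ?_
    have := hlog k
    gcongr
  · rw [div_mul_eq_mul_div, div_le_iff₀ hL, one_mul]
    rcases (abs_nonneg (β * k - round (β * k))).eq_or_lt with h0 | h0
    · rw [← h0, mul_zero]; exact hL.le
    rw [← le_div_iff₀ h0]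
    refine (norm_sum_log_mul_le (fun m => e (m * (β * k))) (1 / |β * k - round (β * k)|) (x / k)
      fun j _ => ?_).trans ?_
    · rw [le_div_iff₀ h0]
      exact norm_sum_Ioc_e_mul_abs_sub_round_le _ _
    · rw [mul_one_div]
      exact div_le_div_of_nonneg_right (hlog k) h0.le

theorem sum_Ioc_sum_divisorsAntidiagonal {R : Type*} [AddCommMonoid R] (F : ℕ → ℕ → R) (N : ℕ) :
    ∑ n ∈ Ioc 0 N, ∑ p ∈ n.divisorsAntidiagonal, F p.1 p.2 =
      ∑ k ∈ Ioc 0 N, ∑ m ∈ Ioc 0 (N / k), F k m := by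
  rw [Finset.sum_sigma', Finset.sum_sigma']
  refine Finset.sum_bij' (fun s _ => ⟨s.2.1, s.2.2⟩) (fun s _ => ⟨s.1 * s.2, (s.1, s.2)⟩)
    ?_ ?_ ?_ ?_ ?_
  · rintro ⟨n, k, m⟩ h
    simp only [Finset.mem_sigma, Finset.mem_Ioc, Nat.mem_divisorsAntidiagonal] at h ⊢
    obtain ⟨⟨h1, h2⟩, h3, h4⟩ := h
    have hk : 0 < k := Nat.pos_of_ne_zero fun h => h4 (by rw [← h3, h, zero_mul])
    have hm : 0 < m := Nat.pos_of_ne_zero fun h => h4 (by rw [← h3, h, mul_zero])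
    have hkm : k ≤ k * m := Nat.le_mul_of_pos_right k hm
    refine ⟨⟨hk, by omega⟩, hm, ?_⟩
    rw [Nat.le_div_iff_mul_le hk, mul_comm]; omega
  · rintro ⟨k, m⟩ h
    simp only [Finset.mem_sigma, Finset.mem_Ioc, Nat.mem_divisorsAntidiagonal] at h ⊢
    obtain ⟨⟨h1, h2⟩, h3, h4⟩ := h
    rw [Nat.le_div_iff_mul_le h1, mul_comm] at h4
    have := Nat.mul_pos h1 h3
    exact ⟨⟨this, h4⟩, trivial, this.ne'⟩
  · rintro ⟨n, k, m⟩ h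
    simp only [Finset.mem_sigma, Finset.mem_Ioc, Nat.mem_divisorsAntidiagonal] at h ⊢
    obtain ⟨-, rfl, -⟩ := h
    rfl
  · rintro ⟨k, m⟩ h
    rfl
  · rintro ⟨n, k, m⟩ h
    rfl

theorem sum_Ioc_inv_le (n : ℕ) : ∑ k ∈ Ioc 0 n, (1 : ℝ) / k ≤ 1 + Real.log n := by
  have h := harmonic_le_one_add_log n
  rw [harmonic_eq_sum_Icc] at h
  push_cast at h
  simpa [one_div, ← Finset.Icc_succ_left_eq_Ioc] using h

theorem card_divisors_eq_sum {R : Type*} [Semiring R] (n : ℕ) :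
    (#n.divisors : R) = ∑ _p ∈ n.divisorsAntidiagonal, (1 : R) := by
  rw [Finset.sum_const, nsmul_eq_mul, mul_one, ← Nat.map_div_right_divisors, Finset.card_map]

theorem sum_card_divisors_le (n : ℕ) :
    ∑ k ∈ Ioc 0 n, (#k.divisors : ℝ) ≤ n * (1 + Real.log n) := by
  simp only [card_divisors_eq_sum]
  rw [sum_Ioc_sum_divisorsAntidiagonal (fun _ _ => (1 : ℝ)) n]
  simp only [Finset.sum_const, Nat.card_Ioc, nsmul_eq_mul, mul_one, Nat.sub_zero]
  calc ∑ k ∈ Ioc 0 n, ((n / k : ℕ) : ℝ) ≤ ∑ k ∈ Ioc 0 n, n * (1 / (k : ℝ)) := by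
        refine Finset.sum_le_sum fun k _ => ?_
        rw [mul_one_div]; exact Nat.cast_div_le
    _ ≤ n * (1 + Real.log n) := by
        rw [← Finset.mul_sum]
        exact mul_le_mul_of_nonneg_left (sum_Ioc_inv_le n) (Nat.cast_nonneg n)

theorem sum_card_divisors_div_le (n : ℕ) :
    ∑ k ∈ Ioc 0 n, (#k.divisors : ℝ) / k ≤ (1 + Real.log n) ^ 2 := by
  have h1 : ∀ k ∈ Ioc 0 n, (#k.divisors : ℝ) / k
      = ∑ p ∈ k.divisorsAntidiagonal, (1 / (p.1 : ℝ)) * (1 / (p.2 : ℝ)) := by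
    intro k _
    rw [card_divisors_eq_sum, Finset.sum_div]
    refine Finset.sum_congr rfl fun p hp => ?_
    rw [← (Nat.mem_divisorsAntidiagonal.1 hp).1]
    push_cast
    rw [div_mul_div_comm, one_mul]
  have hL : 0 ≤ Real.log n := Real.log_natCast_nonneg n
  rw [Finset.sum_congr rfl h1,
    sum_Ioc_sum_divisorsAntidiagonal (fun a b => (1 / (a : ℝ)) * (1 / (b : ℝ))) n]
  calc ∑ k ∈ Ioc 0 n, ∑ m ∈ Ioc 0 (n / k), 1 / (k : ℝ) * (1 / (m : ℝ))
      ≤ ∑ k ∈ Ioc 0 n, 1 / (k : ℝ) * (1 + Real.log n) := by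
        refine Finset.sum_le_sum fun k _ => ?_
        rw [← Finset.mul_sum]
        have := (sum_Ioc_inv_le (n / k)).trans (add_le_add le_rfl (log_natCast_div_le n k))
        gcongr
    _ ≤ (1 + Real.log n) ^ 2 := by
        rw [← Finset.sum_mul, sq]
        exact mul_le_mul_of_nonneg_right (sum_Ioc_inv_le n) (by positivity)

theorem card_divisors_mul_le (a b : ℕ) : #(a * b).divisors ≤ #a.divisors * #b.divisors := by
  rw [Nat.divisors_mul]
  exact Finset.card_mul_le

theorem sum_card_divisors_sq_le (n : ℕ) :
    ∑ k ∈ Ioc 0 n, (#k.divisors : ℝ) ^ 2 ≤ n * (1 + Real.log n) ^ 3 := by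
  have hL : 0 ≤ Real.log n := Real.log_natCast_nonneg n
  calc ∑ k ∈ Ioc 0 n, (#k.divisors : ℝ) ^ 2
      ≤ ∑ k ∈ Ioc 0 n, ∑ p ∈ k.divisorsAntidiagonal, (#p.1.divisors : ℝ) * #p.2.divisors := by
        refine Finset.sum_le_sum fun k _ => ?_
        rw [sq]
        nth_rewrite 1 [card_divisors_eq_sum]
        rw [Finset.sum_mul]
        refine Finset.sum_le_sum fun p hp => ?_
        rw [← (Nat.mem_divisorsAntidiagonal.1 hp).1, one_mul]
        exact_mod_cast card_divisors_mul_le p.1 p.2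
    _ = ∑ k ∈ Ioc 0 n, ∑ m ∈ Ioc 0 (n / k), (#k.divisors : ℝ) * #m.divisors :=
        sum_Ioc_sum_divisorsAntidiagonal (fun a b => (#a.divisors : ℝ) * #b.divisors) n
    _ ≤ ∑ k ∈ Ioc 0 n, n * (1 + Real.log n) * ((#k.divisors : ℝ) / k) := by
        refine Finset.sum_le_sum fun k _ => ?_
        rw [← Finset.mul_sum]
        have h1 := sum_card_divisors_le (n / k)
        have h2 := log_natCast_div_le n k
        have h3 : ((n / k : ℕ) : ℝ) ≤ (n : ℝ) / k := Nat.cast_div_le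
        calc (#k.divisors : ℝ) * ∑ m ∈ Ioc 0 (n / k), (#m.divisors : ℝ)
            ≤ #k.divisors * ((n / k : ℝ) * (1 + Real.log n)) := by
              refine mul_le_mul_of_nonneg_left (h1.trans ?_) (Nat.cast_nonneg _)
              gcongr
          _ = _ := by ring
    _ ≤ n * (1 + Real.log n) * (1 + Real.log n) ^ 2 := by
        rw [← Finset.mul_sum]
        exact mul_le_mul_of_nonneg_left (sum_card_divisors_div_le n) (by positivity)
    _ = n * (1 + Real.log n) ^ 3 := by ring

theorem abs_neg_sub_round_neg_le (x : ℝ) : |-x - round (-x)| ≤ |x - round x| := by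
  refine (round_le (-x) (-round x)).trans_eq ?_
  push_cast
  rw [← abs_neg]; congr 1; ring

theorem sum_sum_mul_mul_le (s : Finset ℕ) (B : ℕ → ℝ) (c : ℕ → ℕ → ℝ) (R : ℝ)
    (hc0 : ∀ i j, 0 ≤ c i j) (h1 : ∀ i ∈ s, ∑ j ∈ s, c i j ≤ R) (h2 : ∀ j ∈ s, ∑ i ∈ s, c i j ≤ R) :
    ∑ i ∈ s, ∑ j ∈ s, B i * B j * c i j ≤ R * ∑ i ∈ s, B i ^ 2 := by
  have hA : ∑ i ∈ s, ∑ j ∈ s, B i ^ 2 * c i j ≤ R * ∑ i ∈ s, B i ^ 2 := by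
    rw [Finset.mul_sum]
    refine Finset.sum_le_sum fun i hi => ?_
    rw [← Finset.mul_sum, mul_comm R]
    exact mul_le_mul_of_nonneg_left (h1 i hi) (sq_nonneg _)
  have hB : ∑ i ∈ s, ∑ j ∈ s, B j ^ 2 * c i j ≤ R * ∑ i ∈ s, B i ^ 2 := by
    rw [Finset.sum_comm, Finset.mul_sum]
    refine Finset.sum_le_sum fun i hi => ?_
    rw [← Finset.mul_sum, mul_comm R]
    exact mul_le_mul_of_nonneg_left (h2 i hi) (sq_nonneg _)
  have hC : 2 * ∑ i ∈ s, ∑ j ∈ s, B i * B j * c i j ≤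
      ∑ i ∈ s, ∑ j ∈ s, B i ^ 2 * c i j + ∑ i ∈ s, ∑ j ∈ s, B j ^ 2 * c i j := by
    rw [← Finset.sum_add_distrib, Finset.mul_sum]
    refine Finset.sum_le_sum fun i _ => ?_
    rw [← Finset.sum_add_distrib, Finset.mul_sum]
    refine Finset.sum_le_sum fun j _ => ?_
    nlinarith [mul_nonneg (sq_nonneg (B i - B j)) (hc0 i j)]
  linarith

theorem sum_norm_sq_sum_mul_e_le (I s : Finset ℕ) (P : ℕ → ℕ → Prop)
    [∀ m k, Decidable (P m k)] (b : ℕ → ℂ) (β : ℝ) :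
    ∑ m ∈ I, ‖∑ k ∈ s with P m k, b k * e (m * (β * k))‖ ^ 2 ≤
      ∑ k ∈ s, ∑ l ∈ s, ‖b k‖ * ‖b l‖ *
        ‖∑ m ∈ I with P m k ∧ P m l, e (m * (β * k - β * l))‖ := by
  have h : ((∑ m ∈ I, ‖∑ k ∈ s with P m k, b k * e (m * (β * k))‖ ^ 2 : ℝ) : ℂ) =
      ∑ k ∈ s, ∑ l ∈ s, b k * (starRingEnd ℂ) (b l) *
        ∑ m ∈ I with P m k ∧ P m l, e (m * (β * k - β * l)) := by
    push_cast
    simp only [← Complex.mul_conj', map_sum, Finset.sum_filter, Finset.sum_mul_sum]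
    rw [Finset.sum_comm]
    refine Finset.sum_congr rfl fun k _ => ?_
    rw [Finset.sum_comm]
    refine Finset.sum_congr rfl fun l _ => ?_
    rw [Finset.mul_sum]
    refine Finset.sum_congr rfl fun m _ => ?_
    by_cases hk : P m k <;> by_cases hl : P m l <;> simp only [hk, hl, if_true, if_false, and_self,
      and_true, and_false, map_zero, mul_zero, zero_mul, map_mul, conj_e]
    have : (m * (β * k - β * l) : ℝ) = m * (β * k) + -(m * (β * l)) := by ring
    rw [this, e_add]; ring
  have h0 : 0 ≤ ∑ m ∈ I, ‖∑ k ∈ s with P m k, b k * e (m * (β * k))‖ ^ 2 :=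
    Finset.sum_nonneg fun _ _ => sq_nonneg _
  rw [← Real.norm_of_nonneg h0, ← Complex.norm_real, h]
  refine (norm_sum_le _ _).trans (Finset.sum_le_sum fun k _ => ?_)
  refine (norm_sum_le _ _).trans (Finset.sum_le_sum fun l _ => ?_)
  rw [norm_mul, norm_mul, RCLike.norm_conj]

theorem sq_norm_bilinear_sum_le {β : ℝ} {q x : ℕ} {a : ℤ} (hq : 0 < q)
    (haq : IsCoprime a (q : ℤ)) (hβ : |β - a / q| ≤ 1 / (q : ℝ) ^ 2) (hqx : q ≤ x)
    {M m₀ m₁ : ℕ} (hM : 0 < M) (hMx : M ≤ x) (hm₀ : M ≤ m₀) (hm₁ : m₁ ≤ 2 * M) (f b : ℕ → ℂ)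
    (hf : ∀ m ∈ Ico m₀ m₁, ‖f m‖ ≤ 1 + Real.log x) (hb : ∀ k, ‖b k‖ ≤ #k.divisors) :
    ‖∑ m ∈ Ico m₀ m₁, f m * ∑ k ∈ Ioc 0 (x / m), b k * e (m * (β * k))‖ ^ 2 ≤
      6 * x * (1 + Real.log x) ^ 6 * (x / q + 2 * M + 2 * (x / M) + q) := by
  have hqR : (0 : ℝ) < q := by exact_mod_cast hq
  have hMR : (0 : ℝ) < M := by exact_mod_cast hM
  have hxR : (1 : ℝ) ≤ x := by exact_mod_cast (by omega : 1 ≤ x)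
  set L := 1 + Real.log x with hL
  have hlx : 0 ≤ Real.log x := Real.log_nonneg hxR
  have hL1 : 1 ≤ L := by linarith
  set I := Ico m₀ m₁
  set K := x / M with hK
  have hIcard : (#I : ℝ) ≤ M := by
    have : #I ≤ M := by rw [Nat.card_Ico]; omega
    exact_mod_cast this
  have hKx : (K : ℝ) ≤ x / M := Nat.cast_div_le
  have hK1 : (1 : ℝ) ≤ x / M := by
    rw [le_div_iff₀ hMR, one_mul]; exact_mod_cast hMx
  have hin : ∀ m ∈ I, ∑ k ∈ Ioc 0 (x / m), b k * e (m * (β * k)) =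
      ∑ k ∈ Ioc 0 K with m ≤ x / k, b k * e (m * (β * k)) := by
    intro m hm
    have hm' := Finset.mem_Ico.1 hm
    refine Finset.sum_congr ?_ fun _ _ => rfl
    ext k
    simp only [Finset.mem_filter, Finset.mem_Ioc]
    constructor
    · rintro ⟨h1, h2⟩
      refine ⟨⟨h1, h2.trans (Nat.div_le_div_left (by omega) hM)⟩, ?_⟩
      rw [Nat.le_div_iff_mul_le (by omega)] at h2 ⊢
      rwa [mul_comm]
    · rintro ⟨⟨h1, -⟩, h2⟩
      refine ⟨h1, ?_⟩
      rw [Nat.le_div_iff_mul_le (by omega)] at h2 ⊢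
      rwa [mul_comm]
  rw [Finset.sum_congr rfl fun m hm => by rw [hin m hm]]
  set c : ℕ → ℕ → ℝ := fun k l =>
    ‖∑ m ∈ I with m ≤ x / k ∧ m ≤ x / l, e (m * (β * k - β * l))‖ with hc
  have hc0 : ∀ k l, 0 ≤ c k l := fun _ _ => norm_nonneg _
  have hcM : ∀ k l, c k l ≤ M := by
    intro k l
    refine (norm_sum_e_le_card _ fun m => m * (β * k - β * l)).trans (le_trans ?_ hIcard)
    exact_mod_cast Finset.card_filter_le _ _
  have hcr : ∀ k l, c k l * |(β * k - β * l) - round (β * k - β * l)| ≤ 1 := by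
    intro k l
    have : {m ∈ I | m ≤ x / k ∧ m ≤ x / l} = Ico m₀ (min m₁ (min (x / k) (x / l) + 1)) := by
      ext m
      simp only [I, Finset.mem_filter, Finset.mem_Ico]
      omega
    simp only [hc, this]
    exact norm_sum_e_mul_abs_sub_round_le _ _ _
  set R : ℝ := (((K + 1 : ℕ) : ℝ) / q + 1) * (6 * (M + q) * (1 + Real.log q)) with hR
  have hsub : Ioc 0 K ⊆ range (K + 1) := fun k hk => by
    simp only [Finset.mem_Ioc, Finset.mem_range] at hk ⊢; omega
  have hR1 : ∀ k ∈ Ioc 0 K, ∑ l ∈ Ioc 0 K, c k l ≤ R := by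
    intro k _
    refine (Finset.sum_le_sum_of_subset_of_nonneg hsub fun l _ _ => hc0 k l).trans ?_
    refine sum_range_le_of_approx_of_le hq haq hβ (-(β * k)) M hMR.le (K + 1) (c k)
      (fun l _ => hc0 k l) (fun l _ => hcM k l) (fun l _ => ?_)
    refine le_trans ?_ (hcr k l)
    have : β * l + -(β * k) = -(β * k - β * l) := by ring
    rw [this]
    exact mul_le_mul_of_nonneg_left (abs_neg_sub_round_neg_le _) (hc0 k l)
  have hR2 : ∀ l ∈ Ioc 0 K, ∑ k ∈ Ioc 0 K, c k l ≤ R := by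
    intro l _
    refine (Finset.sum_le_sum_of_subset_of_nonneg hsub fun k _ _ => hc0 k l).trans ?_
    refine sum_range_le_of_approx_of_le hq haq hβ (-(β * l)) M hMR.le (K + 1) (fun k => c k l)
      (fun k _ => hc0 k l) (fun k _ => hcM k l) (fun k _ => ?_)
    simpa only [sub_eq_add_neg] using hcr k l
  have hR0 : 0 ≤ R := by
    have : 0 ≤ Real.log q := Real.log_natCast_nonneg q
    positivity
  have hRle : R ≤ 6 * L * (x / M / q + 1 / q + 1) * (M + q) := by
    have hLq : 1 + Real.log q ≤ L := by
      have := Real.log_le_log hqR (by exact_mod_cast hqx : (q : ℝ) ≤ x)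
      linarith
    have : 0 ≤ Real.log q := Real.log_natCast_nonneg q
    calc R ≤ ((x / M + 1) / q + 1) * (6 * (M + q) * L) := by
          rw [hR]; push_cast; gcongr
      _ = _ := by ring
  have hsq : ∑ m ∈ I, ‖∑ k ∈ Ioc 0 K with m ≤ x / k, b k * e (m * (β * k))‖ ^ 2 ≤
      R * (x / M * L ^ 3) := by
    refine (sum_norm_sq_sum_mul_e_le I (Ioc 0 K) (fun m k => m ≤ x / k) b β).trans ?_
    refine (sum_sum_mul_mul_le (Ioc 0 K) (fun k => ‖b k‖) c R hc0 hR1 hR2).trans ?_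
    refine mul_le_mul_of_nonneg_left ?_ hR0
    calc ∑ k ∈ Ioc 0 K, ‖b k‖ ^ 2 ≤ ∑ k ∈ Ioc 0 K, (#k.divisors : ℝ) ^ 2 :=
          Finset.sum_le_sum fun k _ => pow_le_pow_left₀ (norm_nonneg _) (hb k) 2
      _ ≤ K * (1 + Real.log K) ^ 3 := sum_card_divisors_sq_le K
      _ ≤ x / M * L ^ 3 := by
          have h1 : Real.log K ≤ Real.log x := log_natCast_div_le x M
          have h2 : 0 ≤ Real.log K := Real.log_natCast_nonneg K
          gcongr
          linarith
  have hf2 : ∑ m ∈ I, ‖f m‖ ^ 2 ≤ M * L ^ 2 := by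
    calc ∑ m ∈ I, ‖f m‖ ^ 2 ≤ ∑ _m ∈ I, L ^ 2 :=
          Finset.sum_le_sum fun m hm => pow_le_pow_left₀ (norm_nonneg _) (hf m hm) 2
      _ = #I * L ^ 2 := by rw [Finset.sum_const, nsmul_eq_mul]
      _ ≤ M * L ^ 2 := by gcongr
  calc ‖∑ m ∈ I, f m * ∑ k ∈ Ioc 0 K with m ≤ x / k, b k * e (m * (β * k))‖ ^ 2
      ≤ (∑ m ∈ I, ‖f m‖ * ‖∑ k ∈ Ioc 0 K with m ≤ x / k, b k * e (m * (β * k))‖) ^ 2 := by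
        refine pow_le_pow_left₀ (norm_nonneg _) ((norm_sum_le _ _).trans_eq ?_) 2
        simp only [norm_mul]
    _ ≤ (∑ m ∈ I, ‖f m‖ ^ 2) *
          ∑ m ∈ I, ‖∑ k ∈ Ioc 0 K with m ≤ x / k, b k * e (m * (β * k))‖ ^ 2 :=
        Finset.sum_mul_sq_le_sq_mul_sq _ _ _
    _ ≤ (M * L ^ 2) * ((6 * L * (x / M / q + 1 / q + 1) * (M + q)) * (x / M * L ^ 3)) := by
        gcongr
        exact hsq.trans (by gcongr)
    _ = 6 * x * L ^ 6 * ((x / q + M + M * (1 / q) + q) + (x / M + 1)) := by field_simp; ring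
    _ ≤ 6 * x * L ^ 6 * (x / q + 2 * M + 2 * (x / M) + q) := by
        have : (M : ℝ) * (1 / q) ≤ M := by
          rw [mul_one_div]; exact div_le_self hMR.le (by exact_mod_cast hq)
        refine mul_le_mul_of_nonneg_left ?_ (by positivity)
        linarith

theorem norm_bilinear_sum_le {β : ℝ} {q x U : ℕ} {a : ℤ} (hU : 0 < U) (hUq : U ≤ 2 * q)
    (hqU : q * U ≤ x) (haq : IsCoprime a (q : ℤ)) (hβ : |β - a / q| ≤ 1 / (q : ℝ) ^ 2) (f b : ℕ → ℂ)
    (hf0 : ∀ m ≤ U, f m = 0) (hf : ∀ m ≤ x, ‖f m‖ ≤ 1 + Real.log x)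
    (hb0 : ∀ k ≤ U, b k = 0) (hb : ∀ k, ‖b k‖ ≤ #k.divisors) :
    ‖∑ m ∈ Ioc 0 x, f m * ∑ k ∈ Ioc 0 (x / m), b k * e (m * (β * k))‖ ≤
      24 * (x / √U) * (1 + Real.log x) ^ 4 := by
  have hq : 0 < q := by omega
  have hqx : q ≤ x := (Nat.le_mul_of_pos_right q hU).trans hqU
  have hx : 0 < x := by omega
  have hqR : (0 : ℝ) < q := by exact_mod_cast hq
  have hUR : (0 : ℝ) < U := by exact_mod_cast hU
  have hxR : (1 : ℝ) ≤ x := by exact_mod_cast hx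
  have hlx : 0 ≤ Real.log x := Real.log_nonneg hxR
  set L := 1 + Real.log x with hL
  have hL0 : 0 < L := by linarith
  set T : ℕ → ℂ := fun m => f m * ∑ k ∈ Ioc 0 (x / m), b k * e (m * (β * k)) with hT
  have hblock : ∀ j, ‖∑ m ∈ Ioc 0 x with Nat.log 2 m = j, T m‖ ≤ 8 * (x / √U) * L ^ 3 := by
    intro j
    set M := 2 ^ j with hM
    have hM0 : 0 < M := by positivity
    have hpos : 0 ≤ 8 * ((x : ℝ) / √U) * L ^ 3 := by positivity
    have hset : {m ∈ Ioc 0 x | Nat.log 2 m = j} = Ico M (min (2 * M) (x + 1)) := by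
      ext m
      simp only [Finset.mem_filter, Finset.mem_Ioc, Finset.mem_Ico, lt_min_iff]
      constructor
      · rintro ⟨⟨h1, h2⟩, h3⟩
        rw [Nat.log_eq_iff (Or.inr ⟨one_lt_two, by omega⟩), pow_succ] at h3
        omega
      · rintro ⟨h1, h2, h3⟩
        refine ⟨by omega, ?_⟩
        rw [Nat.log_eq_iff (Or.inr ⟨one_lt_two, by omega⟩), pow_succ]
        omega
    rw [hset]
    rcases le_or_gt (2 * M) U with h1 | h1
    · rw [Finset.sum_eq_zero]
      · simpa using hpos
      · intro m hm
        simp only [Finset.mem_Ico, lt_min_iff] at hm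
        simp only [hT, hf0 m (by omega), zero_mul]
    rcases lt_or_ge x (M * U) with h2 | h2
    · rw [Finset.sum_eq_zero]
      · simpa using hpos
      · intro m hm
        simp only [Finset.mem_Ico, lt_min_iff] at hm
        simp only [hT]
        rw [Finset.sum_eq_zero, mul_zero]
        intro k hk
        have hk2 := (Finset.mem_Ioc.1 hk).2
        rw [Nat.le_div_iff_mul_le (by omega)] at hk2
        have : k ≤ U := by
          by_contra h
          have : M * U ≤ k * m := by
            rw [mul_comm]; exact Nat.mul_le_mul (by omega) hm.1
          omega
        rw [hb0 k this, zero_mul]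
    have hMx : M ≤ x := (Nat.le_mul_of_pos_right M hU).trans h2
    have hMR : (0 : ℝ) < M := by exact_mod_cast hM0
    have h := sq_norm_bilinear_sum_le hq haq hβ hqx hM0 hMx le_rfl
      (min_le_left (2 * M) (x + 1)) f b (fun m hm => hf m ?_) hb
    · have e1 : (x : ℝ) / q ≤ 2 * (x / U) := by
        rw [← mul_div_assoc, div_le_div_iff₀ hqR hUR]
        have : (U : ℝ) ≤ 2 * q := by exact_mod_cast hUq
        nlinarith
      have e2 : (M : ℝ) ≤ x / U := by
        rw [le_div_iff₀ hUR]; exact_mod_cast h2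
      have e3 : (x : ℝ) / M ≤ 2 * (x / U) := by
        rw [← mul_div_assoc, div_le_div_iff₀ hMR hUR]
        have : (U : ℝ) ≤ 2 * M := by exact_mod_cast h1.le
        nlinarith
      have e4 : (q : ℝ) ≤ x / U := by
        rw [le_div_iff₀ hUR]; exact_mod_cast hqU
      refine le_of_sq_le_sq (h.trans ?_) hpos
      calc 6 * x * L ^ 6 * (x / q + 2 * M + 2 * (x / M) + q)
          ≤ 6 * x * L ^ 6 * (9 * (x / U) + 10 / 6 * (x / U)) := by
            refine mul_le_mul_of_nonneg_left ?_ (by positivity)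
            have : 0 ≤ (x : ℝ) / U := by positivity
            linarith
        _ = (8 * (x / √U) * L ^ 3) ^ 2 := by
            rw [mul_pow, mul_pow, div_pow, Real.sq_sqrt hUR.le]; ring
    · simp only [Finset.mem_Ico, lt_min_iff] at hm
      omega
  have hmaps : ∀ m ∈ Ioc 0 x, Nat.log 2 m ∈ range (Nat.log 2 x + 1) := fun m hm => by
    rw [Finset.mem_range, Nat.lt_succ_iff]
    exact Nat.log_mono_right (Finset.mem_Ioc.1 hm).2
  rw [← Finset.sum_fiberwise_of_maps_to hmaps]
  have hJ : (Nat.log 2 x : ℝ) + 1 ≤ 3 * L := by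
    have h1 : ((2 ^ Nat.log 2 x : ℕ) : ℝ) ≤ x := by exact_mod_cast Nat.pow_log_le_self 2 hx.ne'
    have h2 := Real.log_le_log (by positivity) h1
    push_cast at h2
    rw [Real.log_pow] at h2
    have := Real.log_two_gt_d9
    have h3 : (0 : ℝ) ≤ Nat.log 2 x := by positivity
    nlinarith
  calc ‖∑ j ∈ range (Nat.log 2 x + 1), ∑ m ∈ Ioc 0 x with Nat.log 2 m = j, T m‖
      ≤ ∑ _j ∈ range (Nat.log 2 x + 1), 8 * (x / √U) * L ^ 3 :=
        (norm_sum_le _ _).trans (Finset.sum_le_sum fun j _ => hblock j)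
    _ = (Nat.log 2 x + 1) * (8 * (x / √U) * L ^ 3) := by
        rw [Finset.sum_const, Finset.card_range, nsmul_eq_mul]; push_cast; ring
    _ ≤ 3 * L * (8 * (x / √U) * L ^ 3) := by gcongr
    _ = 24 * (x / √U) * L ^ 4 := by ring

namespace ArithmeticFunction

theorem real_sub_apply (f g : ArithmeticFunction ℝ) (n : ℕ) : (f - g) n = f n - g n := by
  rw [eq_sub_iff_add_eq, ← add_apply, sub_add_cancel]

/-- The restriction of an arithmetic function to arguments at most U. -/
def truncate {R : Type*} [Zero R] (f : ArithmeticFunction R) (U : ℕ) : ArithmeticFunction R :=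
  ⟨fun n => if n ≤ U then f n else 0, by simp⟩

theorem truncate_apply {R : Type*} [Zero R] (f : ArithmeticFunction R) (U n : ℕ) :
    f.truncate U n = if n ≤ U then f n else 0 := rfl

/-- **Vaughan's identity**. -/
theorem vonMangoldt_eq_vaughan (U V : ℕ) :
    vonMangoldt = vonMangoldt.truncate U + (moebius : ArithmeticFunction ℝ).truncate V * log
      - (moebius : ArithmeticFunction ℝ).truncate V * vonMangoldt.truncate U *
        (zeta : ArithmeticFunction ℝ)
      + (vonMangoldt - vonMangoldt.truncate U) *
        (((moebius : ArithmeticFunction ℝ) - (moebius : ArithmeticFunction ℝ).truncate V) *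
          (zeta : ArithmeticFunction ℝ)) := by
  have h1 : (moebius : ArithmeticFunction ℝ) * (zeta : ArithmeticFunction ℝ) = 1 :=
    coe_moebius_mul_coe_zeta
  have h2 : vonMangoldt * (zeta : ArithmeticFunction ℝ) = log := vonMangoldt_mul_zeta
  rw [← h2]
  linear_combination (vonMangoldt.truncate U - vonMangoldt) * h1

/-- The exponential sum attached to an arithmetic function. -/
noncomputable def expSum (f : ArithmeticFunction ℝ) (β : ℝ) (x : ℕ) : ℂ :=
  ∑ n ∈ Ioc 0 x, (f n : ℂ) * e (n * β)

theorem expSum_add (f g : ArithmeticFunction ℝ) (β : ℝ) (x : ℕ) :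
    expSum (f + g) β x = expSum f β x + expSum g β x := by
  simp only [expSum, ← Finset.sum_add_distrib]
  exact Finset.sum_congr rfl fun n _ => by rw [add_apply]; push_cast; ring

theorem expSum_sub (f g : ArithmeticFunction ℝ) (β : ℝ) (x : ℕ) :
    expSum (f - g) β x = expSum f β x - expSum g β x := by
  simp only [expSum, ← Finset.sum_sub_distrib]
  exact Finset.sum_congr rfl fun n _ => by rw [real_sub_apply]; push_cast; ring

theorem expSum_mul (f g : ArithmeticFunction ℝ) (β : ℝ) (x : ℕ) :
    expSum (f * g) β x =
      ∑ k ∈ Ioc 0 x, (f k : ℂ) * ∑ m ∈ Ioc 0 (x / k), (g m : ℂ) * e (m * (β * k)) := by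
  simp only [Finset.mul_sum]
  rw [← sum_Ioc_sum_divisorsAntidiagonal
    (fun k m => (f k : ℂ) * ((g m : ℂ) * e (m * (β * k)))) x, expSum]
  refine Finset.sum_congr rfl fun n _ => ?_
  rw [mul_apply, Complex.ofReal_sum, Finset.sum_mul]
  refine Finset.sum_congr rfl fun p hp => ?_
  rw [← (Nat.mem_divisorsAntidiagonal.1 hp).1]
  push_cast
  rw [show (p.1 * p.2 * β : ℝ) = p.2 * (β * p.1) by ring]
  ring

theorem norm_expSum_mul_le (f g : ArithmeticFunction ℝ) (β : ℝ) {x K : ℕ} {B : ℝ} (hK : K ≤ x)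
    (hf0 : ∀ k, K < k → f k = 0) (hf : ∀ k ∈ Ioc 0 K, |f k| ≤ B) :
    ‖expSum (f * g) β x‖ ≤
      B * ∑ k ∈ Ioc 0 K, ‖∑ m ∈ Ioc 0 (x / k), (g m : ℂ) * e (m * (β * k))‖ := by
  rw [expSum_mul, ← Finset.sum_subset (Finset.Ioc_subset_Ioc_right hK), Finset.mul_sum]
  · refine (norm_sum_le _ _).trans (Finset.sum_le_sum fun k hk => ?_)
    rw [norm_mul, Complex.norm_real, Real.norm_eq_abs]
    exact mul_le_mul_of_nonneg_right (hf k hk) (norm_nonneg _)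
  · intro k hk hk'
    simp only [Finset.mem_Ioc] at hk hk'
    rw [hf0 k (by omega)]; simp

theorem abs_moebius_real_le_one (n : ℕ) : |(moebius : ArithmeticFunction ℝ) n| ≤ 1 := by
  rw [intCoe_apply]
  exact_mod_cast abs_moebius_le_one

theorem abs_truncate_le {f : ArithmeticFunction ℝ} {U n : ℕ} : |f.truncate U n| ≤ |f n| := by
  rw [truncate_apply]; split_ifs <;> simp

theorem abs_sub_truncate_le {f : ArithmeticFunction ℝ} {U n : ℕ} :
    |(f - f.truncate U) n| ≤ |f n| := by
  rw [real_sub_apply, truncate_apply]; split_ifs <;> simp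

theorem sub_truncate_eq_zero {f : ArithmeticFunction ℝ} {U n : ℕ} (h : n ≤ U) :
    (f - f.truncate U) n = 0 := by
  rw [real_sub_apply, truncate_apply, if_pos h, sub_self]

theorem truncate_mul_truncate_eq_zero (f g : ArithmeticFunction ℝ) (U V n : ℕ) (h : U * V < n) :
    (f.truncate U * g.truncate V) n = 0 := by
  rw [mul_apply]
  refine Finset.sum_eq_zero fun p hp => ?_
  have hp1 := (Nat.mem_divisorsAntidiagonal.1 hp).1
  rw [truncate_apply, truncate_apply]
  by_cases h1 : p.1 ≤ U
  · by_cases h2 : p.2 ≤ V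
    · have := Nat.mul_le_mul h1 h2
      omega
    · rw [if_neg h2, mul_zero]
  · rw [if_neg h1, zero_mul]

theorem abs_truncate_moebius_mul_le (U V n : ℕ) :
    |((moebius : ArithmeticFunction ℝ).truncate U * vonMangoldt.truncate V) n| ≤ Real.log n := by
  rw [mul_apply, ← vonMangoldt_sum, ← Nat.sum_divisorsAntidiagonal' fun _ d => vonMangoldt d]
  refine (Finset.abs_sum_le_sum_abs _ _).trans (Finset.sum_le_sum fun p _ => ?_)
  rw [abs_mul]
  have h1 : |(moebius : ArithmeticFunction ℝ).truncate U p.1| ≤ 1 :=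
    abs_truncate_le.trans (abs_moebius_real_le_one _)
  have h2 : |vonMangoldt.truncate V p.2| ≤ vonMangoldt p.2 :=
    abs_truncate_le.trans_eq (abs_of_nonneg vonMangoldt_nonneg)
  calc _ ≤ 1 * vonMangoldt p.2 := mul_le_mul h1 h2 (abs_nonneg _) zero_le_one
    _ = _ := one_mul _

theorem abs_sub_truncate_moebius_mul_zeta_le (U n : ℕ) :
    |(((moebius : ArithmeticFunction ℝ) - (moebius : ArithmeticFunction ℝ).truncate U) *
      (zeta : ArithmeticFunction ℝ)) n| ≤ #n.divisors := by
  rw [coe_mul_zeta_apply]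
  refine (Finset.abs_sum_le_sum_abs _ _).trans ?_
  calc _ ≤ ∑ _d ∈ n.divisors, (1 : ℝ) := Finset.sum_le_sum fun d _ =>
        abs_sub_truncate_le.trans (abs_moebius_real_le_one _)
    _ = _ := by simp

theorem sub_truncate_mul_zeta_eq_zero (f : ArithmeticFunction ℝ) {U n : ℕ} (h : n ≤ U) :
    ((f - f.truncate U) * (zeta : ArithmeticFunction ℝ)) n = 0 := by
  rw [coe_mul_zeta_apply]
  exact Finset.sum_eq_zero fun d hd => sub_truncate_eq_zero ((Nat.divisor_le hd).trans h)

theorem abs_vonMangoldt_le {n x : ℕ} (h : n ≤ x) : |vonMangoldt n| ≤ 1 + Real.log x := by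
  rw [abs_of_nonneg vonMangoldt_nonneg]
  rcases n.eq_zero_or_pos with rfl | hn
  · simpa using add_nonneg zero_le_one (Real.log_natCast_nonneg x)
  · have := Real.log_le_log (by exact_mod_cast hn) (by exact_mod_cast h : (n : ℝ) ≤ x)
    linarith [vonMangoldt_le_log (n := n)]

theorem norm_expSum_truncate_vonMangoldt_le (β : ℝ) {x U : ℕ} (hU : U ≤ x) :
    ‖expSum (vonMangoldt.truncate U) β x‖ ≤ U * (1 + Real.log x) := by
  rw [expSum, ← Finset.sum_subset (Finset.Ioc_subset_Ioc_right hU)]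
  · refine (norm_sum_le _ _).trans ?_
    calc _ ≤ ∑ _n ∈ Ioc 0 U, (1 + Real.log x) := Finset.sum_le_sum fun n hn => by
          rw [norm_mul, norm_e, mul_one, Complex.norm_real, Real.norm_eq_abs]
          exact abs_truncate_le.trans (abs_vonMangoldt_le ((Finset.mem_Ioc.1 hn).2.trans hU))
      _ = _ := by rw [Finset.sum_const, Nat.card_Ioc, nsmul_eq_mul, Nat.sub_zero]
  · intro n hn hn'
    simp only [Finset.mem_Ioc] at hn hn'
    rw [truncate_apply, if_neg (by omega)]; simp

theorem norm_expSum_sub_truncate_mul_le {β : ℝ} {q x U : ℕ} {a : ℤ} (hU : 0 < U)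
    (hUq : U ≤ 2 * q) (hqU : q * U ≤ x) (haq : IsCoprime a (q : ℤ))
    (hβ : |β - a / q| ≤ 1 / (q : ℝ) ^ 2) :
    ‖expSum ((vonMangoldt - vonMangoldt.truncate U) *
      (((moebius : ArithmeticFunction ℝ) - (moebius : ArithmeticFunction ℝ).truncate U) *
        (zeta : ArithmeticFunction ℝ))) β x‖ ≤ 24 * (x / √U) * (1 + Real.log x) ^ 4 := by
  rw [expSum_mul]
  refine (congrArg norm (Finset.sum_congr rfl fun k _ => congrArg _ (Finset.sum_congr rfl
    fun m _ => ?_))).trans_le (norm_bilinear_sum_le hU hUq hqU haq hβ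
    (fun m => ((vonMangoldt - vonMangoldt.truncate U) m : ℂ))
    (fun k => (((((moebius : ArithmeticFunction ℝ) - (moebius : ArithmeticFunction ℝ).truncate U) *
        (zeta : ArithmeticFunction ℝ)) k : ℝ) : ℂ)) (fun m hm => ?_) (fun m hm => ?_)
    (fun k hk => ?_) (fun k => ?_))
  · rw [mul_left_comm, mul_comm (m : ℝ), mul_left_comm]
  · rw [sub_truncate_eq_zero hm, Complex.ofReal_zero]
  · rw [Complex.norm_real, Real.norm_eq_abs]
    exact abs_sub_truncate_le.trans (abs_vonMangoldt_le hm)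
  · rw [sub_truncate_mul_zeta_eq_zero _ hk, Complex.ofReal_zero]
  · rw [Complex.norm_real, Real.norm_eq_abs]
    exact abs_sub_truncate_moebius_mul_zeta_le U k

/-- Vinogradov's estimate for exponential sums over prime powers. -/
theorem norm_expSum_vonMangoldt_le {β : ℝ} {q x U : ℕ} {a : ℤ} (hU : 0 < U) (hUq : U ≤ 2 * q)
    (hqU : q * U ≤ x) (hUx : U ^ 3 ≤ x) (haq : IsCoprime a (q : ℤ))
    (hβ : |β - a / q| ≤ 1 / (q : ℝ) ^ 2) :
    ‖expSum vonMangoldt β x‖ ≤ 277 * (x / √U) * (1 + Real.log x) ^ 4 := by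
  have hq : 0 < q := by omega
  have hqx : q ≤ x := (Nat.le_mul_of_pos_right q hU).trans hqU
  have hUU : U * U ≤ x := le_trans (by nlinarith [Nat.mul_le_mul hU (le_refl (U * U))]) hUx
  have hUx' : U ≤ x := (Nat.le_mul_of_pos_right U hU).trans hUU
  have hx : 0 < x := by omega
  have hqR : (0 : ℝ) < q := by exact_mod_cast hq
  have hUR : (1 : ℝ) ≤ U := by exact_mod_cast hU
  have hU0 : (0 : ℝ) < U := by linarith
  have hxR : (1 : ℝ) ≤ x := by exact_mod_cast hx
  have hlx : 0 ≤ Real.log x := Real.log_nonneg hxR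
  have hsum := sum_norm_sum_e_le hq haq hβ hqx hUU
  have hsumlog := sum_norm_sum_log_mul_e_le hq haq hβ hqx hUx'
  set L := 1 + Real.log x with hL
  have hL1 : 1 ≤ L := by linarith
  set W : ℝ := x / U with hW
  have hW0 : 0 ≤ W := by positivity
  have hWx : W ≤ x / √U := by
    refine div_le_div_of_nonneg_left (by positivity) (by positivity) ?_
    rw [Real.sqrt_le_left hU0.le]; nlinarith
  have hUU_le : (U : ℝ) * U ≤ W := by
    rw [le_div_iff₀ hU0]
    exact_mod_cast (by linarith [pow_succ U 2, pow_two U] : U * U * U ≤ x)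
  have hU_le : (U : ℝ) ≤ W := by nlinarith
  have hq_le : (q : ℝ) ≤ W := by rw [le_div_iff₀ hU0]; exact_mod_cast hqU
  have hxq_le : (x : ℝ) / q ≤ 2 * W := by
    rw [hW, ← mul_div_assoc, div_le_div_iff₀ hqR hU0]
    have : (U : ℝ) ≤ 2 * q := by exact_mod_cast hUq
    nlinarith
  have hbr : ∀ {K : ℝ}, K ≤ W → 3 * K + 3 * q + 4 * (x / q) * L ≤ 14 * (W * L) := by
    intro K hK
    have h1 : W ≤ W * L := le_mul_of_one_le_right hW0 hL1
    have h2 : (x : ℝ) / q * L ≤ 2 * W * L := by gcongr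
    nlinarith
  have h1 : ‖expSum (vonMangoldt.truncate U) β x‖ ≤ (x / √U) * L ^ 4 :=
    calc _ ≤ U * L := norm_expSum_truncate_vonMangoldt_le β hUx'
      _ ≤ (x / √U) * L ^ 4 := mul_le_mul (hU_le.trans hWx) (le_self_pow₀ hL1 (by norm_num))
          (by positivity) (by positivity)
  have hWL : W * L ^ 3 ≤ x / √U * L ^ 4 :=
    mul_le_mul hWx (pow_le_pow_right₀ hL1 (by norm_num)) (by positivity) (by positivity)
  have h2 : ‖expSum ((moebius : ArithmeticFunction ℝ).truncate U * log) β x‖ ≤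
      168 * (x / √U * L ^ 4) := by
    refine (norm_expSum_mul_le _ _ β hUx' (B := 1) (fun k hk => ?_) (fun k _ => ?_)).trans ?_
    · rw [truncate_apply, if_neg (by omega)]
    · exact abs_truncate_le.trans (abs_moebius_real_le_one _)
    · simp only [log_apply, one_mul]
      refine hsumlog.trans ?_
      calc _ ≤ 2 * L * (6 * L * (14 * (W * L))) := by gcongr; exact hbr hU_le
        _ = 168 * (W * L ^ 3) := by ring
        _ ≤ _ := by gcongr
  have h3 : ‖expSum ((moebius : ArithmeticFunction ℝ).truncate U * vonMangoldt.truncate U *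
      (zeta : ArithmeticFunction ℝ)) β x‖ ≤ 84 * (x / √U * L ^ 4) := by
    refine (norm_expSum_mul_le _ _ β hUU (B := L) (fun k hk => ?_) (fun k hk => ?_)).trans ?_
    · exact truncate_mul_truncate_eq_zero _ _ _ _ _ hk
    · rw [Finset.mem_Ioc] at hk
      have := Real.log_le_log (by exact_mod_cast hk.1)
        (by exact_mod_cast hk.2.trans hUU : (k : ℝ) ≤ x)
      linarith [abs_truncate_moebius_mul_le U U k]
    · have hz : ∀ k, ∑ m ∈ Ioc 0 (x / k), (((zeta : ArithmeticFunction ℝ) m : ℝ) : ℂ) *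
          e (m * (β * k)) = ∑ m ∈ Ioc 0 (x / k), e (m * (β * k)) := fun k =>
        Finset.sum_congr rfl fun m hm => by
          rw [natCoe_apply, zeta_apply_ne (Finset.mem_Ioc.1 hm).1.ne']; simp
      simp only [hz]
      calc _ ≤ L * (6 * L * (14 * (W * L))) := by
            refine mul_le_mul_of_nonneg_left (hsum.trans ?_) (by positivity)
            refine mul_le_mul_of_nonneg_left (hbr ?_) (by positivity)
            push_cast; exact hUU_le
        _ = 84 * (W * L ^ 3) := by ring
        _ ≤ _ := by gcongr
  have h4 : ‖expSum ((vonMangoldt - vonMangoldt.truncate U) *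
      (((moebius : ArithmeticFunction ℝ) - (moebius : ArithmeticFunction ℝ).truncate U) *
        (zeta : ArithmeticFunction ℝ))) β x‖ ≤ 24 * (x / √U * L ^ 4) := by
    have h := norm_expSum_sub_truncate_mul_le hU hUq hqU haq hβ
    rwa [mul_assoc] at h
  rw [vonMangoldt_eq_vaughan U U, expSum_add, expSum_sub, expSum_add]
  refine (norm_add_le_of_le (norm_sub_le_of_le (norm_add_le_of_le h1 h2) h3) h4).trans_eq ?_
  ring

end ArithmeticFunction

theorem Ftilde_eq_sum_Ioc (A α : ℝ) :
    Ftilde A α = ∑ n ∈ Ioc 0 ⌊A⌋₊,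
      ((if Nat.Prime n ∧ 2 < n then Real.log n else 0 : ℝ) : ℂ) * e (n * (2 * α)) := by
  have hset : (Finset.range (⌊A⌋₊ + 1)).filter (fun p => Nat.Prime p ∧ 2 < p ∧ (p : ℝ) ≤ A) =
      (Ioc 0 ⌊A⌋₊).filter (fun n => Nat.Prime n ∧ 2 < n) := by
    ext p
    simp only [Finset.mem_filter, Finset.mem_range, Finset.mem_Ioc]
    constructor
    · rintro ⟨h1, h2, h3, _⟩
      exact ⟨⟨by omega, by omega⟩, h2, h3⟩
    · rintro ⟨⟨h1, h2⟩, h3, h4⟩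
      exact ⟨by omega, h3, h4, (Nat.le_floor_iff' h1.ne').1 h2⟩
  rw [Ftilde, hset, Finset.sum_filter]
  refine Finset.sum_congr rfl fun n _ => ?_
  split_ifs
  · rw [show α * (2 * (n : ℝ)) = n * (2 * α) by ring]
  · simp

theorem norm_Ftilde_le {A : ℝ} (hA : 1 ≤ A) (α : ℝ) :
    ‖Ftilde A α‖ ≤ ‖ArithmeticFunction.expSum ArithmeticFunction.vonMangoldt (2 * α) ⌊A⌋₊‖ +
      (1 + 2 * √⌊A⌋₊ * Real.log ⌊A⌋₊) := by
  set x := ⌊A⌋₊ with hx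
  have hx1 : (1 : ℝ) ≤ x := by exact_mod_cast (Nat.le_floor (by exact_mod_cast hA) : 1 ≤ x)
  have hpt : ∀ n, |ArithmeticFunction.vonMangoldt n -
      (if Nat.Prime n ∧ 2 < n then Real.log n else 0)| =
        (if ¬ n.Prime then ArithmeticFunction.vonMangoldt n else 0) +
          (if n = 2 then Real.log 2 else 0) := by
    intro n
    by_cases hn : n.Prime
    · rcases hn.two_le.eq_or_lt with rfl | h2
      · simp [ArithmeticFunction.vonMangoldt_apply_prime hn, hn, abs_of_nonneg,
          Real.log_nonneg one_le_two]
      · simp [ArithmeticFunction.vonMangoldt_apply_prime hn, hn, h2, h2.ne']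
    · have h2 : n ≠ 2 := fun h => hn (h ▸ Nat.prime_two)
      simp [hn, h2, ArithmeticFunction.vonMangoldt_nonneg]
  have hdiff : ‖ArithmeticFunction.expSum ArithmeticFunction.vonMangoldt (2 * α) x -
      Ftilde A α‖ ≤ 1 + 2 * √x * Real.log x := by
    rw [Ftilde_eq_sum_Ioc, ArithmeticFunction.expSum, ← hx, ← Finset.sum_sub_distrib]
    refine (norm_sum_le _ _).trans ?_
    calc _ = ∑ n ∈ Ioc 0 x, ((if ¬ n.Prime then ArithmeticFunction.vonMangoldt n else 0) +
          (if n = 2 then Real.log 2 else 0)) := by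
          refine Finset.sum_congr rfl fun n _ => ?_
          rw [← sub_mul, norm_mul, norm_e, mul_one, ← Complex.ofReal_sub, Complex.norm_real,
            Real.norm_eq_abs, hpt]
      _ ≤ 2 * √x * Real.log x + 1 := by
          rw [Finset.sum_add_distrib]
          refine add_le_add ?_ ?_
          · have h := Chebyshev.psi_sub_theta_le hx1
            rw [Chebyshev.psi_sub_theta_eq_sum_not_prime, Nat.floor_natCast] at h
            rwa [← Finset.sum_filter]
          · rw [Finset.sum_ite_eq']
            split_ifs
            · linarith [Real.log_two_lt_d9]
            · exact zero_le_one
      _ = _ := add_comm _ _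
  calc ‖Ftilde A α‖ = ‖ArithmeticFunction.expSum ArithmeticFunction.vonMangoldt (2 * α) x -
        (ArithmeticFunction.expSum ArithmeticFunction.vonMangoldt (2 * α) x - Ftilde A α)‖ := by
        rw [sub_sub_cancel]
    _ ≤ _ := (norm_sub_le _ _).trans (by gcongr)

/-- Vinogradov's estimate for the exponential sum over primes. -/
theorem norm_Ftilde_le_of_approx {A α : ℝ} {q U : ℕ} {a : ℤ} (hU : 0 < U) (hUq : U ≤ 2 * q)
    (hqU : q * U ≤ A) (hUA : (U : ℝ) ^ 3 ≤ A) (haq : IsCoprime a (q : ℤ))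
    (hα : |2 * α - a / q| ≤ 1 / (q : ℝ) ^ 2) :
    ‖Ftilde A α‖ ≤ 280 * (A / √U) * (1 + Real.log A) ^ 4 := by
  have hU1 : (1 : ℝ) ≤ U := by exact_mod_cast hU
  have hU0 : (0 : ℝ) < U := by linarith
  have hA : 1 ≤ A := (one_le_pow₀ hU1).trans hUA
  have hqU' : q * U ≤ ⌊A⌋₊ := Nat.le_floor (by push_cast; exact hqU)
  have hUA' : U ^ 3 ≤ ⌊A⌋₊ := Nat.le_floor (by push_cast; exact hUA)
  have hxA : (⌊A⌋₊ : ℝ) ≤ A := Nat.floor_le (by linarith)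
  have hx1 : (1 : ℝ) ≤ ⌊A⌋₊ := by exact_mod_cast (Nat.le_floor (by exact_mod_cast hA))
  have hl : Real.log ⌊A⌋₊ ≤ Real.log A := Real.log_le_log (by linarith) hxA
  have hl0 : 0 ≤ Real.log ⌊A⌋₊ := Real.log_nonneg hx1
  have hUleA : (U : ℝ) ≤ A := (le_self_pow₀ hU1 (by norm_num)).trans hUA
  have hsq : √⌊A⌋₊ ≤ A / √U := by
    rw [le_div_iff₀ (Real.sqrt_pos.2 hU0)]
    calc √⌊A⌋₊ * √U ≤ √A * √A := by gcongr
      _ = A := Real.mul_self_sqrt (by linarith)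
  have hone : 1 ≤ A / √U := le_trans (by rw [Real.one_le_sqrt]; exact hx1) hsq
  set L := 1 + Real.log A with hL
  have hL1 : 1 ≤ L := by linarith
  have hLL : L ≤ L ^ 4 := le_self_pow₀ hL1 (by norm_num)
  have hmain : ‖ArithmeticFunction.expSum ArithmeticFunction.vonMangoldt (2 * α) ⌊A⌋₊‖ ≤
      277 * (A / √U) * L ^ 4 := by
    refine (ArithmeticFunction.norm_expSum_vonMangoldt_le hU hUq hqU' hUA' haq hα).trans ?_
    have : 1 + Real.log ⌊A⌋₊ ≤ L := by linarith
    gcongr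
  refine (norm_Ftilde_le hA α).trans ?_
  have h1 : 1 ≤ A / √U * L ^ 4 := one_le_mul_of_one_le_of_one_le hone (one_le_pow₀ hL1)
  have h2 : √⌊A⌋₊ * Real.log ⌊A⌋₊ ≤ A / √U * L ^ 4 :=
    mul_le_mul hsq (by linarith) hl0 (by linarith)
  linarith

theorem exists_approx_two_mul_of_forall_lt {α τ Q : ℝ} (hQ : 1 ≤ Q) (hτ : 2 * Q ≤ τ)
    (hα : α ∈ Set.Icc (-(1 / τ)) (1 - 1 / τ))
    (h : ∀ q a : ℕ, 1 ≤ q → (q : ℝ) ≤ Q → a < q → Nat.gcd a q = 1 → 1 / τ < |α - (a : ℝ) / q|) :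
    ∃ (q : ℕ) (b : ℤ), IsCoprime b (q : ℤ) ∧ |2 * α - b / q| ≤ 1 / (q : ℝ) ^ 2 ∧
      (q : ℝ) ≤ τ ∧ Q < 2 * q := by
  have hτ0 : 0 < τ := by linarith
  obtain ⟨r, hr, hrn⟩ := Real.exists_rat_abs_sub_le_and_den_le (2 * α)
    (Nat.floor_pos.2 (by linarith : 1 ≤ τ))
  have hd1 : (1 : ℝ) ≤ r.den := by exact_mod_cast r.den_pos
  have hd0 : (0 : ℝ) < r.den := by linarith
  have hrτ : (r.den : ℝ) ≤ τ := (Nat.le_floor_iff hτ0.le).1 hrn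
  have hr' : |2 * α - r| ≤ 1 / (τ * r.den) := hr.trans (by
    gcongr
    exact (Nat.lt_floor_add_one τ).le)
  refine ⟨r.den, r.num, Int.isCoprime_iff_nat_coprime.2 (by simpa using r.reduced), ?_, hrτ, ?_⟩
  · rw [← Rat.cast_def]
    exact hr'.trans (by rw [pow_two]; gcongr)
  by_contra! hle
  set s : ℚ := r * (1 / 2) with hs
  have hsden : s.den ≤ 2 * r.den := by
    have h1 := Rat.mul_den_dvd r (1 / 2)
    have h2 : ((1 : ℚ) / 2).den = 2 := by norm_num
    rw [h2] at h1
    exact (Nat.le_of_dvd (Nat.mul_pos r.den_pos two_pos) h1).trans_eq (mul_comm _ _)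
  have hsQ : (s.den : ℝ) ≤ Q := le_trans (by exact_mod_cast hsden) hle
  have hs0 : (0 : ℝ) < s.den := by exact_mod_cast s.den_pos
  have hsr : (s : ℝ) = r / 2 := by rw [hs]; push_cast; ring
  have hclose : |α - s| ≤ 1 / τ / 2 := by
    have h1 : |2 * α - r| ≤ 1 / τ := hr'.trans (by
      gcongr
      exact le_mul_of_one_le_right hτ0.le hd1)
    rw [hsr, show α - r / 2 = (2 * α - r) / 2 by ring, abs_div, abs_two]
    linarith
  have hτinv : 0 < 1 / τ := by positivity
  obtain ⟨hc1, hc2⟩ := abs_le.1 hclose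
  have hsdef : (s : ℝ) = s.num / s.den := Rat.cast_def s
  have hnum0 : 0 ≤ s.num := by
    by_contra! hneg
    have h1 : (s.num : ℝ) ≤ -1 := by exact_mod_cast (by omega : s.num ≤ -1)
    have h2 : (s : ℝ) ≤ -(1 / Q) := by
      calc (s : ℝ) = s.num / s.den := hsdef
        _ ≤ -1 / s.den := by gcongr
        _ = -(1 / s.den) := neg_div _ _
        _ ≤ -(1 / Q) := by gcongr
    have h3 : 2 * (1 / τ) ≤ 1 / Q := by
      rw [← mul_div_assoc, div_le_div_iff₀ hτ0 (by linarith)]; linarith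
    linarith [hα.1]
  have hnumlt : s.num < s.den := by
    have h1 : (s : ℝ) < 1 := by linarith [hα.2]
    rw [hsdef, div_lt_one hs0] at h1
    exact_mod_cast h1
  have hcast : ((s.num.toNat : ℕ) : ℝ) = s.num := by
    exact_mod_cast Int.toNat_of_nonneg hnum0
  have hlt := h s.den s.num.toNat s.den_pos hsQ (by omega) (by
    have := s.reduced
    rwa [show s.num.natAbs = s.num.toNat by omega] at this)
  rw [hcast, ← hsdef] at hlt
  linarith

theorem eventually_two_mul_rpow_log_le (lam : ℝ) :
    ∀ᶠ N : ℕ in Filter.atTop, 16 ≤ Real.log N ∧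
      2 * Real.log N ^ lam ≤ Real.exp (1 / 2 * Real.log N) := by
  have hlog : Filter.Tendsto (fun N : ℕ => Real.log N) Filter.atTop Filter.atTop :=
    Real.tendsto_log_atTop.comp tendsto_natCast_atTop_atTop
  refine (hlog.eventually_ge_atTop 16).and (hlog.eventually
    (p := fun l => 2 * l ^ lam ≤ Real.exp (1 / 2 * l)) ?_)
  filter_upwards [(isLittleO_rpow_exp_pos_mul_atTop lam (by norm_num : (0 : ℝ) < 1 / 2)).def
    (by norm_num : (0 : ℝ) < 1 / 2)] with l hl
  rw [Real.norm_of_nonneg (Real.exp_pos _).le] at hl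
  linarith [Real.le_norm_self (l ^ lam)]

theorem Aof_bounds {ε lam : ℝ} (hlam : 0 < lam) (hε : ε ∈ Set.Ioo (0 : ℝ) 1) {N : ℕ}
    (hN : 16 ≤ Real.log N)
    (h : 2 * Real.log N ^ (3 * lam) ≤ Real.exp (1 / 2 * Real.log N)) :
    Aof ε N ≤ N ∧ 1 ≤ Qof lam N ∧ Qof lam N ^ 3 ≤ Aof ε N ∧
      2 * Qof lam N ≤ tauof ε lam N := by
  have hN0 : (0 : ℝ) < N := by
    rcases N.eq_zero_or_pos with rfl | hN0
    · norm_num at hN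
    · exact_mod_cast hN0
  set l := Real.log N with hl
  have hA : Aof ε N = Real.exp (l - ε * √l) := by
    rw [Aof, ← hl, neg_mul, sub_eq_add_neg, Real.exp_add, hl, Real.exp_log hN0]
  have hQ : Qof lam N = l ^ lam := rfl
  have hsq : √l ≤ l / 4 := by rw [Real.sqrt_le_left (by linarith)]; nlinarith
  have hεl : ε * √l ≤ l / 4 :=
    (mul_le_of_le_one_left (Real.sqrt_nonneg l) hε.2.le).trans hsq
  have hQ3 : (l ^ lam) ^ 3 = l ^ (3 * lam) := by
    rw [← Real.rpow_natCast, ← Real.rpow_mul (by linarith)]; congr 1; push_cast; ring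
  have hQ1 : 1 ≤ l ^ lam := Real.one_le_rpow (by linarith) hlam.le
  have hQ0 : 0 < l ^ lam := by linarith
  refine ⟨?_, hQ ▸ hQ1, ?_, ?_⟩
  · exact mul_le_of_le_one_right hN0.le (Real.exp_le_one_iff.2 (by
      have := mul_nonneg hε.1.le (Real.sqrt_nonneg l); linarith))
  · rw [hQ, hQ3, hA]
    have : Real.exp (1 / 2 * l) ≤ Real.exp (l - ε * √l) := Real.exp_le_exp.2 (by linarith)
    have : 0 ≤ l ^ (3 * lam) := by positivity
    linarith
  · have h2 : 2 * (l ^ lam) ^ 2 ≤ Real.exp (1 / 2 * l) := by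
      have := pow_le_pow_right₀ hQ1 (by norm_num : 2 ≤ 3)
      linarith
    have h3 : Real.exp (1 / 2 * l) * N ≤ Aof ε N ^ 2 := by
      rw [hA, ← Real.exp_log hN0, ← hl, ← Real.exp_add, ← Real.exp_nat_mul]
      exact Real.exp_le_exp.2 (by push_cast; linarith)
    rw [tauof, hQ, ← div_eq_mul_inv, ← div_eq_mul_inv, le_div_iff₀ hQ0, le_div_iff₀ hN0]
    calc 2 * l ^ lam * l ^ lam * N = 2 * (l ^ lam) ^ 2 * N := by ring
      _ ≤ Real.exp (1 / 2 * l) * N := by gcongr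
      _ ≤ _ := h3

theorem stmt11 (lam ε : ℝ) (hlam : 0 < lam) (hε : ε ∈ Set.Ioo (0 : ℝ) 1) :
    ∃ C > (0 : ℝ), ∃ N₀ : ℕ, ∀ N : ℕ, N₀ ≤ N → Even N →
      ∀ α ∈ Minor ε lam N,
        ‖Ftilde (Aof ε N) α‖ ≤ C * Aof ε N / Real.log N ^ (lam / 2 - 4) := by
  obtain ⟨N₀, hN₀⟩ := Filter.eventually_atTop.1 (eventually_two_mul_rpow_log_le (3 * lam))
  refine ⟨8960, by norm_num, N₀, fun N hN _ α hα => ?_⟩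
  obtain ⟨hl16, hpow⟩ := hN₀ N hN
  obtain ⟨hAN, hQ1, hQA, hQτ⟩ := Aof_bounds hlam hε hl16 hpow
  obtain ⟨q, b, hcop, happ, hqτ, hQq⟩ := exists_approx_two_mul_of_forall_lt hQ1 hQτ hα.1
    fun q a h1 h2 h3 h4 => lt_of_not_ge fun h5 => hα.2 ⟨hα.1, q, a, h1, h2, h3, h4, h5⟩
  set A := Aof ε N with hA
  set Q := Qof lam N with hQ
  set U := ⌊Q⌋₊ with hU
  have hUQ : (U : ℝ) ≤ Q := Nat.floor_le (by linarith)
  have hU1 : 1 ≤ U := Nat.le_floor (by exact_mod_cast hQ1)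
  have hU1' : (1 : ℝ) ≤ U := by exact_mod_cast hU1
  have hQU : Q < U + 1 := Nat.lt_floor_add_one Q
  have hA1 : 1 ≤ A := (one_le_pow₀ hQ1).trans hQA
  have hN0 : (0 : ℝ) < N := by linarith
  have hqU : (q : ℝ) * U ≤ A :=
    calc (q : ℝ) * U ≤ tauof ε lam N * Q := mul_le_mul hqτ hUQ (by positivity) (by linarith)
      _ = A * (A / N) := by rw [tauof, ← hA, ← hQ]; field_simp
      _ ≤ A * 1 := by gcongr; exact (div_le_one hN0).2 hAN
      _ = A := mul_one A
  have hUq : U ≤ 2 * q := by exact_mod_cast (hUQ.trans hQq.le : (U : ℝ) ≤ 2 * q)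
  have hF := norm_Ftilde_le_of_approx hU1 hUq hqU
    ((pow_le_pow_left₀ (by positivity) hUQ 3).trans hQA) hcop happ
  set l := Real.log N with hl
  have hlA : Real.log A ≤ l := Real.log_le_log (by linarith) hAN
  have hlA0 : 0 ≤ Real.log A := Real.log_nonneg hA1
  have hsqrtQ : √Q = l ^ (lam / 2) := by
    rw [hQ, Qof, ← hl, Real.sqrt_eq_rpow, ← Real.rpow_mul (by linarith)]; ring_nf
  have hQ0 : 0 < √Q := Real.sqrt_pos.2 (by linarith)
  have hsqrtU : √Q / 2 ≤ √U := by
    rw [Real.le_sqrt' (by positivity), div_pow, Real.sq_sqrt (by linarith)]; linarith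
  calc ‖Ftilde A α‖ ≤ 280 * (A / √U) * (1 + Real.log A) ^ 4 := hF
    _ ≤ 280 * (A / (√Q / 2)) * (2 * l) ^ 4 := by gcongr; linarith
    _ = 8960 * A / l ^ (lam / 2 - 4) := by
      rw [hsqrtQ, Real.rpow_sub (by linarith), show (4 : ℝ) = (4 : ℕ) by norm_num,
        Real.rpow_natCast]
      have : 0 < l ^ (lam / 2) := hsqrtQ ▸ hQ0
      field_simp
      ring
end
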